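/- Let f be continuous satisfying (P), (KO) and condition (1.5), and let u₁, u₂ be two large solutions of Δu = f(u) in the open unit ball B of ℝ^N. Then the gradient of u₁ − u₂ is bounded on B: there exists C > 0 such that ‖∇u₁(x) − ∇u₂(x)‖ ≤ C for all x ∈ B. -/

import Mathlib

open MeasureTheory Filter Metric Set

/-- The Laplacian of `u : ℝ^N → ℝ` at a point, as the sum of the second
derivatives in the coordinate directions. -/
noncomputable def lapl {N : ℕ} (u : EuclideanSpace ℝ (Fin N) → ℝ)
    (x : EuclideanSpace ℝ (Fin N)) : ℝ :=
  ∑ i : Fin N, iteratedFDeriv ℝ 2 u x ![EuclideanSpace.single i 1, EuclideanSpace.single i 1]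

/-- A large solution of Δu = f(u) on the open unit ball of ℝ^N. -/
def IsLargeSolution {N : ℕ} (f : ℝ → ℝ) (u : EuclideanSpace ℝ (Fin N) → ℝ) : Prop :=
  ContDiffOn ℝ 2 u (ball 0 1) ∧
  (∀ x ∈ ball (0 : EuclideanSpace ℝ (Fin N)) 1, lapl u x = f (u x)) ∧
  ∀ x₀ ∈ sphere (0 : EuclideanSpace ℝ (Fin N)) 1,
    Tendsto u (nhdsWithin x₀ (ball 0 1)) atTop

section OneVariable

open scoped Topology

/-- `g` has first derivative `d₁` and second derivative `d₂` at `t₀`. -/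
def HasTwoDerivAt (g : ℝ → ℝ) (d₁ d₂ t₀ : ℝ) : Prop :=
  ∃ g' : ℝ → ℝ, (∀ᶠ t in 𝓝 t₀, HasDerivAt g (g' t) t) ∧ g' t₀ = d₁ ∧ HasDerivAt g' d₂ t₀

variable {g h : ℝ → ℝ} {a₁ a₂ b₁ b₂ t₀ : ℝ}

theorem HasTwoDerivAt.of_forall {g g' : ℝ → ℝ} {d₂ t₀ : ℝ} (hg : ∀ t, HasDerivAt g (g' t) t)
    (hg' : HasDerivAt g' d₂ t₀) : HasTwoDerivAt g (g' t₀) d₂ t₀ :=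
  ⟨g', Eventually.of_forall hg, rfl, hg'⟩

theorem HasTwoDerivAt.add (hg : HasTwoDerivAt g a₁ a₂ t₀) (hh : HasTwoDerivAt h b₁ b₂ t₀) :
    HasTwoDerivAt (fun t => g t + h t) (a₁ + b₁) (a₂ + b₂) t₀ := by
  obtain ⟨g', hg, rfl, hg'⟩ := hg
  obtain ⟨h', hh, rfl, hh'⟩ := hh
  exact ⟨fun t => g' t + h' t, by filter_upwards [hg, hh] with t h₁ h₂ using h₁.add h₂, rfl,
    hg'.add hh'⟩

theorem HasTwoDerivAt.sub (hg : HasTwoDerivAt g a₁ a₂ t₀) (hh : HasTwoDerivAt h b₁ b₂ t₀) :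
    HasTwoDerivAt (fun t => g t - h t) (a₁ - b₁) (a₂ - b₂) t₀ := by
  obtain ⟨g', hg, rfl, hg'⟩ := hg
  obtain ⟨h', hh, rfl, hh'⟩ := hh
  exact ⟨fun t => g' t - h' t, by filter_upwards [hg, hh] with t h₁ h₂ using h₁.sub h₂, rfl,
    hg'.sub hh'⟩

theorem HasTwoDerivAt.const_mul (c : ℝ) (hg : HasTwoDerivAt g a₁ a₂ t₀) :
    HasTwoDerivAt (fun t => c * g t) (c * a₁) (c * a₂) t₀ := by
  obtain ⟨g', hg, rfl, hg'⟩ := hg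
  exact ⟨fun t => c * g' t, by filter_upwards [hg] with t h₁ using h₁.const_mul c, rfl,
    hg'.const_mul c⟩

theorem HasTwoDerivAt.comp {η : ℝ → ℝ} (hg : HasTwoDerivAt g a₁ a₂ (η t₀))
    (hη : HasTwoDerivAt η b₁ b₂ t₀) :
    HasTwoDerivAt (fun t => g (η t)) (a₁ * b₁) (a₂ * b₁ ^ 2 + a₁ * b₂) t₀ := by
  obtain ⟨g', hg, rfl, hg'⟩ := hg
  obtain ⟨η', hη, rfl, hη'⟩ := hη
  refine ⟨fun t => g' (η t) * η' t, ?_, rfl, ?_⟩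
  · filter_upwards [hη.self_of_nhds.continuousAt.eventually hg, hη] with t h₁ h₂ using h₁.comp t h₂
  · exact ((hg'.comp t₀ hη.self_of_nhds).mul hη').congr_deriv
      (by rw [Function.comp_apply, sq, mul_assoc])

theorem HasTwoDerivAt.of_isLocalMax (hg : HasTwoDerivAt g a₁ a₂ t₀) (hmax : IsLocalMax g t₀) :
    a₁ = 0 ∧ a₂ ≤ 0 := by
  obtain ⟨g', hg, rfl, hg'⟩ := hg
  have h₁ : g' t₀ = 0 := hmax.hasDerivAt_eq_zero hg.self_of_nhds
  refine ⟨h₁, ?_⟩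
  by_contra! hpos
  have hev : deriv g =ᶠ[𝓝 t₀] g' := by filter_upwards [hg] with t ht using ht.deriv
  have hd : deriv (deriv g) t₀ = a₂ := by rw [hev.deriv_eq, hg'.deriv]
  have hmin : IsLocalMin g t₀ := isLocalMin_of_deriv_deriv_pos (hd ▸ hpos)
    (hev.self_of_nhds.trans h₁) hg.self_of_nhds.continuousAt
  have hconst : g =ᶠ[𝓝 t₀] fun _ => g t₀ := by
    filter_upwards [hmax, hmin] with t h₁ h₂ using le_antisymm h₁ h₂
  have : deriv (deriv g) t₀ = 0 := by
    rw [hconst.deriv.deriv_eq]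
    simp
  linarith

/-- If `g 0 = 0` and `g t ≤ C t` for small `t > 0`, then `g' 0 ≤ C`. -/
theorem HasDerivAt.le_of_eventually_le {g : ℝ → ℝ} {d C : ℝ} (hg : HasDerivAt g d 0)
    (h₀ : g 0 = 0) (hle : ∀ᶠ t in 𝓝[>] (0 : ℝ), g t ≤ C * t) : d ≤ C := by
  have hsub : Ioi (0 : ℝ) ⊆ {0}ᶜ := fun t ht => (mem_Ioi.1 ht).ne'
  have ht := (hasDerivAt_iff_tendsto_slope_zero.1 hg).mono_left (nhdsWithin_mono 0 hsub)
  refine le_of_tendsto ht ?_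
  filter_upwards [hle, self_mem_nhdsWithin] with t h₁ (h₂ : 0 < t)
  simp only [zero_add, h₀, sub_zero, smul_eq_mul]
  rw [inv_mul_le_iff₀ h₂]
  linarith

end OneVariable

section SeveralVariables

open scoped Topology InnerProductSpace

variable {N : ℕ} {u : EuclideanSpace ℝ (Fin N) → ℝ} {x : EuclideanSpace ℝ (Fin N)}

theorem hasTwoDerivAt_curve {γ γ' : ℝ → EuclideanSpace ℝ (Fin N)} {c : EuclideanSpace ℝ (Fin N)}
    {t₀ : ℝ} (hu : ContDiffAt ℝ 2 u (γ t₀)) (hγ : ∀ t, HasDerivAt γ (γ' t) t)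
    (hγ' : HasDerivAt γ' c t₀) :
    HasTwoDerivAt (fun t => u (γ t)) (fderiv ℝ u (γ t₀) (γ' t₀))
      (fderiv ℝ (fderiv ℝ u) (γ t₀) (γ' t₀) (γ' t₀) + fderiv ℝ u (γ t₀) c) t₀ := by
  refine ⟨fun t => fderiv ℝ u (γ t) (γ' t), ?_, rfl, ?_⟩
  · filter_upwards [(hγ t₀).continuousAt.eventually (hu.eventually (by simp))] with t ht
    exact (ht.differentiableAt (by simp)).hasFDerivAt.comp_hasDerivAt t (hγ t)
  · have h₁ : DifferentiableAt ℝ (fderiv ℝ u) (γ t₀) :=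
      (hu.fderiv_right (m := 1) (by norm_num)).differentiableAt (by simp)
    exact (h₁.hasFDerivAt.comp_hasDerivAt t₀ (hγ t₀)).clm_apply hγ'

theorem hasTwoDerivAt_line (hu : ContDiffAt ℝ 2 u x) (v : EuclideanSpace ℝ (Fin N)) :
    HasTwoDerivAt (fun t : ℝ => u (x + t • v)) (fderiv ℝ u x v)
      (fderiv ℝ (fderiv ℝ u) x v v) 0 := by
  have h₁ : ∀ t : ℝ, HasDerivAt (fun t : ℝ => x + t • v) v t := fun t => by
    simpa using ((hasDerivAt_id t).smul_const v).const_add x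
  have := hasTwoDerivAt_curve (γ := fun t : ℝ => x + t • v) (t₀ := 0) (by simpa using hu) h₁
    (hasDerivAt_const 0 v)
  simpa using this

/-- The restriction of `u` to a ray, as a function of the distance to the origin. -/
theorem hasTwoDerivAt_ray {ω : EuclideanSpace ℝ (Fin N)} {r : ℝ}
    (hu : ContDiffAt ℝ 2 u (r • ω)) :
    HasTwoDerivAt (fun t : ℝ => u (t • ω)) (fderiv ℝ u (r • ω) ω)
      (fderiv ℝ (fderiv ℝ u) (r • ω) ω ω) r := by
  have h₁ : ∀ t : ℝ, HasDerivAt (fun t : ℝ => t • ω) ω t := fun t => by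
    simpa using (hasDerivAt_id t).smul_const ω
  have := hasTwoDerivAt_curve (γ := fun t : ℝ => t • ω) (t₀ := r) hu h₁ (hasDerivAt_const r ω)
  simpa using this

theorem lapl_eq_sum (b : OrthonormalBasis (Fin N) ℝ (EuclideanSpace ℝ (Fin N))) :
    lapl u x = ∑ i, fderiv ℝ (fderiv ℝ u) x (b i) (b i) := by
  have h₁ := congrFun (InnerProductSpace.laplacian_eq_iteratedFDeriv_orthonormalBasis u
    (EuclideanSpace.basisFun (Fin N) ℝ)) x
  have h₂ := congrFun (InnerProductSpace.laplacian_eq_iteratedFDeriv_orthonormalBasis u b) x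
  simp only [EuclideanSpace.basisFun_apply] at h₁
  rw [lapl, ← h₁, h₂]
  simp [iteratedFDeriv_two_apply]

theorem lapl_eq_sum_isometry (R : EuclideanSpace ℝ (Fin N) ≃ₗᵢ[ℝ] EuclideanSpace ℝ (Fin N)) :
    lapl u x = ∑ i, fderiv ℝ (fderiv ℝ u) x (R (EuclideanSpace.single i 1))
      (R (EuclideanSpace.single i 1)) := by
  rw [lapl_eq_sum ((EuclideanSpace.basisFun (Fin N) ℝ).map R)]
  simp

theorem exists_isometry_map_eq {v w : EuclideanSpace ℝ (Fin N)} (h : ‖v‖ = ‖w‖) :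
    ∃ R : EuclideanSpace ℝ (Fin N) ≃ₗᵢ[ℝ] EuclideanSpace ℝ (Fin N), R v = w :=
  ⟨_, Submodule.reflection_sub h⟩

/-- At a point where `u` is maximal on a sphere centred at the origin, the tangential part of the
Laplacian is at most the one of a radial function. -/
theorem lapl_le_of_isMaxOn_sphere (hN : 1 ≤ N) {ω : EuclideanSpace ℝ (Fin N)} {r : ℝ}
    (hr : 0 < r) (hω : ‖ω‖ = 1) (hu : ContDiffAt ℝ 2 u (r • ω))
    (hmax : ∀ ω', ‖ω'‖ = 1 → u (r • ω') ≤ u (r • ω)) :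
    lapl u (r • ω) ≤ fderiv ℝ (fderiv ℝ u) (r • ω) ω ω
      + (N - 1) / r * fderiv ℝ u (r • ω) ω := by
  let i₀ : Fin N := ⟨0, hN⟩
  obtain ⟨R, hR⟩ := exists_isometry_map_eq
    (v := EuclideanSpace.single i₀ (1 : ℝ)) (w := ω) (by simp [hω])
  have hort : ∀ i, i ≠ i₀ → ⟪ω, R (EuclideanSpace.single i 1)⟫_ℝ = 0 := fun i hi => by
    rw [← hR, R.inner_map_map]
    simp [EuclideanSpace.inner_single_left, hi.symm]
  have htan : ∀ i, i ≠ i₀ → fderiv ℝ (fderiv ℝ u) (r • ω) (R (EuclideanSpace.single i 1))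
      (R (EuclideanSpace.single i 1)) ≤ fderiv ℝ u (r • ω) ω / r := by
    intro i hi
    set e := R (EuclideanSpace.single i 1) with he
    have hen : ‖e‖ = 1 := by rw [he, R.norm_map]; simp
    have hγ : ∀ t : ℝ, HasDerivAt (fun t : ℝ => r • (Real.cos t • ω + Real.sin t • e))
        (r • ((-Real.sin t) • ω + Real.cos t • e)) t := fun t =>
      (((Real.hasDerivAt_cos t).smul_const ω).add
        ((Real.hasDerivAt_sin t).smul_const e)).const_smul r
    have hγ' : HasDerivAt (fun t : ℝ => r • ((-Real.sin t) • ω + Real.cos t • e))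
        (r • ((-Real.cos 0) • ω + (-Real.sin 0) • e)) 0 :=
      (((Real.hasDerivAt_sin 0).neg.smul_const ω).add
        ((Real.hasDerivAt_cos 0).smul_const e)).const_smul r
    have h₂ := hasTwoDerivAt_curve (u := u)
      (γ := fun t : ℝ => r • (Real.cos t • ω + Real.sin t • e)) (t₀ := 0)
      (by simpa using hu) hγ hγ'
    have hloc : IsLocalMax (fun t : ℝ => u (r • (Real.cos t • ω + Real.sin t • e))) 0 := by
      refine Eventually.of_forall fun t => ?_
      have hn : ‖Real.cos t • ω + Real.sin t • e‖ = 1 := by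
        have : ‖Real.cos t • ω + Real.sin t • e‖ ^ 2 = 1 := by
          rw [norm_add_sq_real, norm_smul, norm_smul, inner_smul_left, inner_smul_right,
            hort i hi, hω, hen]
          simp
        nlinarith [norm_nonneg (Real.cos t • ω + Real.sin t • e)]
      simpa using hmax _ hn
    have h₃ := (h₂.of_isLocalMax hloc).2
    simp only [Real.cos_zero, Real.sin_zero, neg_zero, zero_smul, one_smul, add_zero, zero_add,
      map_smul, smul_eq_mul, FunLike.coe_smul, Pi.smul_apply, neg_smul, smul_neg, map_neg] at h₃
    rw [le_div_iff₀ hr]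
    have : r * (fderiv ℝ (fderiv ℝ u) (r • ω) e e * r - fderiv ℝ u (r • ω) ω) ≤ 0 := by linarith
    nlinarith
  have hcard : ((Finset.univ.erase i₀).card : ℝ) = N - 1 := by
    rw [Finset.card_erase_of_mem (Finset.mem_univ _), Finset.card_univ, Fintype.card_fin,
      Nat.cast_sub hN, Nat.cast_one]
  rw [lapl_eq_sum_isometry R, ← Finset.add_sum_erase _ _ (Finset.mem_univ i₀), hR]
  refine add_le_add_right ?_ _
  calc _ ≤ ∑ i ∈ Finset.univ.erase i₀, fderiv ℝ u (r • ω) ω / r :=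
        Finset.sum_le_sum fun i hi => htan i (Finset.ne_of_mem_erase hi)
    _ = _ := by rw [Finset.sum_const, nsmul_eq_mul, hcard]; ring

theorem lapl_neg : lapl (fun y => -u y) x = -lapl u x := by
  have h₁ := congrFun (InnerProductSpace.laplacian_eq_iteratedFDeriv_orthonormalBasis u
    (EuclideanSpace.basisFun (Fin N) ℝ)) x
  have h₂ := congrFun (InnerProductSpace.laplacian_eq_iteratedFDeriv_orthonormalBasis (-u)
    (EuclideanSpace.basisFun (Fin N) ℝ)) x
  simp only [EuclideanSpace.basisFun_apply] at h₁ h₂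
  change lapl (-u) x = _
  rw [lapl, lapl, ← h₁, ← h₂, InnerProductSpace.laplacian_neg]
  rfl

theorem le_lapl_of_isMinOn_sphere (hN : 1 ≤ N) {ω : EuclideanSpace ℝ (Fin N)} {r : ℝ}
    (hr : 0 < r) (hω : ‖ω‖ = 1) (hu : ContDiffAt ℝ 2 u (r • ω))
    (hmin : ∀ ω', ‖ω'‖ = 1 → u (r • ω) ≤ u (r • ω')) :
    fderiv ℝ (fderiv ℝ u) (r • ω) ω ω + (N - 1) / r * fderiv ℝ u (r • ω) ω
      ≤ lapl u (r • ω) := by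
  have h := lapl_le_of_isMaxOn_sphere hN hr hω hu.neg
    (fun ω' h' => neg_le_neg (hmin ω' h'))
  have h₁ : fderiv ℝ (fun y => -u y) = fun y => -fderiv ℝ u y := by
    ext1 y; exact fderiv_fun_neg
  rw [lapl_neg, h₁, fderiv_fun_neg] at h
  simp only [FunLike.coe_neg, Pi.neg_apply] at h
  linarith

end SeveralVariables

section LargeSolutions

open scoped Topology

/-- A solution of `Δu = f(u)` in the unit ball that blows up uniformly at the boundary and stays
above `a` at distance at least `r₀` from the origin. -/
structure BlowsUpAbove {N : ℕ} (f : ℝ → ℝ) (a r₀ : ℝ) (u : EuclideanSpace ℝ (Fin N) → ℝ) :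
    Prop where
  contDiffAt : ∀ x, ‖x‖ < 1 → ContDiffAt ℝ 2 u x
  lapl_eq : ∀ x, ‖x‖ < 1 → lapl u x = f (u x)
  blowup : ∀ c, ∃ r < 1, ∀ x, r ≤ ‖x‖ → ‖x‖ < 1 → c < u x
  gt : ∀ x, r₀ ≤ ‖x‖ → ‖x‖ < 1 → a < u x

variable {N : ℕ} {f : ℝ → ℝ} {a K r₀ : ℝ} {u v : EuclideanSpace ℝ (Fin N) → ℝ}

theorem IsLargeSolution.exists_forall_lt (hu : IsLargeSolution f u) (c : ℝ) :
    ∃ r < 1, ∀ x, r ≤ ‖x‖ → ‖x‖ < 1 → c < u x := by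
  set A := {x : EuclideanSpace ℝ (Fin N) | ‖x‖ < 1 ∧ u x ≤ c} with hA
  have hAball : A ⊆ ball 0 1 := fun x hx => by simpa using hx.1
  have hAc : closure A ⊆ closedBall 0 1 :=
    closure_minimal (hAball.trans ball_subset_closedBall) isClosed_closedBall
  have hcpt : IsCompact (closure A) := (isCompact_closedBall _ _).of_isClosed_subset
    isClosed_closure hAc
  have hlt : ∀ x ∈ closure A, ‖x‖ < 1 := by
    intro x hx
    refine lt_of_le_of_ne (by simpa using hAc hx) fun h1 => ?_
    have hne : (𝓝[A] x).NeBot := mem_closure_iff_nhdsWithin_neBot.1 hx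
    have ht := (hu.2.2 x (by simpa using h1)).mono_left (nhdsWithin_mono x hAball)
    obtain ⟨y, hy₁, hy₂⟩ := ((ht.eventually_gt_atTop c).and self_mem_nhdsWithin).exists
    exact absurd hy₁ (not_lt.2 hy₂.2)
  rcases (closure A).eq_empty_or_nonempty with he | hne
  · refine ⟨0, one_pos, fun x _ hx => ?_⟩
    by_contra! hc
    exact (he ▸ subset_closure (show x ∈ A from ⟨hx, hc⟩) : x ∈ (∅ : Set _))
  · obtain ⟨z, hz, hmax⟩ := hcpt.exists_isMaxOn hne continuous_norm.continuousOn
    have hz1 := hlt z hz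
    refine ⟨(1 + ‖z‖) / 2, by linarith, fun x hx hx1 => ?_⟩
    by_contra! hc
    have : ‖x‖ ≤ ‖z‖ := hmax (subset_closure (show x ∈ A from ⟨hx1, hc⟩))
    linarith

theorem IsLargeSolution.blowsUpAbove (hu : IsLargeSolution f u)
    (hgt : ∀ x, r₀ ≤ ‖x‖ → ‖x‖ < 1 → a < u x) : BlowsUpAbove f a r₀ u where
  contDiffAt x hx := hu.1.contDiffAt (isOpen_ball.mem_nhds (by simpa using hx))
  lapl_eq x hx := hu.2.1 x (by simpa using hx)
  blowup := hu.exists_forall_lt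
  gt := hgt

theorem BlowsUpAbove.continuousOn (hu : BlowsUpAbove f a r₀ u) : ContinuousOn u (ball 0 1) :=
  fun x hx => (hu.contDiffAt x (by simpa using hx)).continuousAt.continuousWithinAt

theorem BlowsUpAbove.exists_le (hu : BlowsUpAbove f a r₀ u) {r : ℝ} (hr : r < 1) :
    ∃ C, ∀ x, ‖x‖ ≤ r → u x ≤ C := by
  obtain ⟨C, hC⟩ := (isCompact_closedBall (0 : EuclideanSpace ℝ (Fin N)) r).bddAbove_image
    (hu.continuousOn.mono (closedBall_subset_ball hr))
  exact ⟨C, fun x hx => hC (mem_image_of_mem u (by simpa using hx))⟩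

theorem hasTwoDerivAt_cubic (c₀ c₁ c₂ c₃ : ℝ) :
    HasTwoDerivAt (fun t => c₀ + c₁ * t + c₂ * t ^ 2 + c₃ * t ^ 3) c₁ (2 * c₂) 0 := by
  have h₁ : ∀ t : ℝ, HasDerivAt (fun t => c₀ + c₁ * t + c₂ * t ^ 2 + c₃ * t ^ 3)
      (c₁ + c₂ * (2 * t) + c₃ * (3 * t ^ 2)) t := fun t => by
    have := (((hasDerivAt_id t).const_mul c₁).const_add c₀).add
      ((hasDerivAt_pow 2 t).const_mul c₂) |>.add ((hasDerivAt_pow 3 t).const_mul c₃)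
    exact this.congr_deriv (by norm_num)
  have h₂ : HasDerivAt (fun t : ℝ => c₁ + c₂ * (2 * t) + c₃ * (3 * t ^ 2)) (2 * c₂) 0 := by
    have := ((((hasDerivAt_id (0 : ℝ)).const_mul 2).const_mul c₂).const_add c₁).add
      (((hasDerivAt_pow 2 (0 : ℝ)).const_mul 3).const_mul c₃)
    exact this.congr_deriv (by norm_num; ring)
  simpa using HasTwoDerivAt.of_forall h₁ h₂

theorem norm_add_smul_single_sq (x : EuclideanSpace ℝ (Fin N)) (i : Fin N) (t : ℝ) :
    ‖x + t • EuclideanSpace.single i (1 : ℝ)‖ ^ 2 = ‖x‖ ^ 2 + 2 * x i * t + t ^ 2 := by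
  rw [norm_add_sq_real, inner_smul_right, norm_smul, EuclideanSpace.inner_single_right]
  simp
  ring

theorem isLocalMax_line {F : EuclideanSpace ℝ (Fin N) → ℝ} {x : EuclideanSpace ℝ (Fin N)}
    (h : IsLocalMax F x) (v : EuclideanSpace ℝ (Fin N)) :
    IsLocalMax (fun t : ℝ => F (x + t • v)) 0 := by
  have hc : ContinuousAt (fun t : ℝ => x + t • v) 0 := by fun_prop
  have : Tendsto (fun t : ℝ => x + t • v) (𝓝 0) (𝓝 x) := by simpa using hc.tendsto
  simpa [IsLocalMax, IsMaxFilter] using this.eventually h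

/-- Solutions are subharmonic where they exceed `a`. -/
theorem BlowsUpAbove.le_of_le_sphere (hN : 1 ≤ N) (hfpos : ∀ t, a < t → 0 ≤ f t)
    (hu : BlowsUpAbove f a r₀ u) {r c : ℝ} (hr : r < 1) (hc : a ≤ c)
    (hsph : ∀ x, ‖x‖ = r → u x ≤ c) (x : EuclideanSpace ℝ (Fin N)) (hx : ‖x‖ ≤ r) :
    u x ≤ c := by
  by_contra! hlt
  set ε := (u x - c) / 2 with hε
  have hε0 : 0 < ε := by rw [hε]; linarith
  obtain ⟨z, hz, hmax⟩ := (isCompact_closedBall (0 : EuclideanSpace ℝ (Fin N)) r).exists_isMaxOn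
    (f := fun y => u y + ε * ‖y‖ ^ 2) ⟨x, by simpa using hx⟩
    ((hu.continuousOn.mono (closedBall_subset_ball hr)).add (by fun_prop))
  have hzr : ‖z‖ ≤ r := by simpa using hz
  have hzx : u x + ε * ‖x‖ ^ 2 ≤ u z + ε * ‖z‖ ^ 2 := hmax (by simpa using hx)
  have hz2 : ‖z‖ ^ 2 ≤ 1 := by nlinarith [norm_nonneg z]
  have huz : c < u z := by nlinarith [sq_nonneg ‖x‖]
  have hzr' : ‖z‖ < r := lt_of_le_of_ne hzr fun h => absurd huz (not_lt.2 (hsph z h))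
  have hloc : IsLocalMax (fun y => u y + ε * ‖y‖ ^ 2) z :=
    hmax.isLocalMax (closedBall_mem_nhds_of_mem (by simpa using hzr'))
  have hi : ∀ i : Fin N, fderiv ℝ (fderiv ℝ u) z (EuclideanSpace.single i 1)
      (EuclideanSpace.single i 1) + 2 * ε ≤ 0 := fun i => by
    have h₁ := (hasTwoDerivAt_line (hu.contDiffAt z (hzr.trans_lt hr))
      (EuclideanSpace.single i 1)).add
      (hasTwoDerivAt_cubic (ε * ‖z‖ ^ 2) (ε * (2 * z i)) ε 0)
    refine (h₁.of_isLocalMax ?_).2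
    convert isLocalMax_line hloc (EuclideanSpace.single i 1) using 2 with t
    rw [norm_add_smul_single_sq]
    ring
  have hsum := Finset.sum_nonpos fun i (_ : i ∈ Finset.univ) => hi i
  rw [Finset.sum_add_distrib, Finset.sum_const, Finset.card_univ, Fintype.card_fin, nsmul_eq_mul]
    at hsum
  have hl := lapl_eq_sum_isometry (u := u) (x := z) (LinearIsometryEquiv.refl ℝ _)
  simp only [LinearIsometryEquiv.coe_refl, id_eq] at hl
  rw [← hl, hu.lapl_eq z (hzr.trans_lt hr)] at hsum
  have hN' : (1 : ℝ) ≤ N := by exact_mod_cast hN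
  have := hfpos (u z) (by linarith)
  nlinarith

theorem reparam_bracket_nonpos {n s η r₀ ε : ℝ} (hn : 1 ≤ n) (hr₀ : 63 / 64 ≤ r₀)
    (hthin : 64 * n * (1 - r₀) ≤ 1) (hε : 0 < ε) (hε1 : ε ≤ 1) (hs : r₀ ≤ s) (hs1 : s ≤ 1)
    (hη : η = s + ε * (1 - 4 * n * (s - r₀) ^ 2)) :
    -(8 * n * ε) + (n - 1) / s * (1 - 8 * n * ε * (s - r₀))
      - (n - 1) / η * (1 - 8 * n * ε * (s - r₀)) ^ 2 ≤ 0 := by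
  set σ := s - r₀ with hσ
  have hσ0 : 0 ≤ σ := by linarith
  have hβσ : n * σ ≤ 1 / 64 := by nlinarith
  have hβσ0 : 0 ≤ n * σ := by positivity
  have hσ1 : σ ≤ 1 / 64 := by linarith
  have hβσ2 : 4 * n * σ ^ 2 ≤ 1 / 2 := by nlinarith
  have hηs : s ≤ η := by rw [hη]; nlinarith
  have hs0 : 0 < s := by linarith
  have hη0 : 0 < η := by linarith
  set d := 1 - 8 * n * ε * σ with hd
  have hd1 : d ≤ 1 := by rw [hd]; nlinarith
  have hd0 : 0 ≤ d := by rw [hd]; nlinarith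
  have hnum : η - s * d ≤ ε * (9 / 8) := by
    have : η - s * d = ε * (1 - 4 * n * σ ^ 2 + 8 * (n * σ) * s) := by rw [hη, hd]; ring
    rw [this]
    refine mul_le_mul_of_nonneg_left ?_ hε.le
    nlinarith [mul_nonneg hβσ0 hσ0]
  have hprod : 9 / 10 ≤ s * η := by nlinarith
  have hkey : (η - s * d) / (s * η) ≤ 2 * ε := by
    rw [div_le_iff₀ (by positivity)]
    nlinarith
  have heq : (n - 1) / s * d - (n - 1) / η * d ^ 2
      = ((n - 1) * d) * ((η - s * d) / (s * η)) := by
    field_simp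
  have hnd : 0 ≤ (n - 1) * d := mul_nonneg (by linarith) hd0
  have hnd' : (n - 1) * d ≤ n := by nlinarith
  have : ((n - 1) * d) * ((η - s * d) / (s * η)) ≤ n * (2 * ε) :=
    (mul_le_mul_of_nonneg_left hkey hnd).trans
      (mul_le_mul_of_nonneg_right hnd' (by positivity))
  have : 0 < n * ε := by positivity
  linarith

theorem hasTwoDerivAt_reparam (n r₀ ε s : ℝ) :
    HasTwoDerivAt (fun t => t + ε * (1 - 4 * n * (t - r₀) ^ 2))
      (1 - 8 * n * ε * (s - r₀)) (-(8 * n * ε)) s := by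
  have h₁ : ∀ t : ℝ, HasDerivAt (fun t => t + ε * (1 - 4 * n * (t - r₀) ^ 2))
      (1 - 8 * n * ε * (t - r₀)) t := fun t => by
    have := (hasDerivAt_id t).add (((((hasDerivAt_id t).sub_const r₀).pow 2).const_mul
      (4 * n)).const_sub 1 |>.const_mul ε)
    exact this.congr_deriv (by simp; ring)
  have h₂ : HasDerivAt (fun t => 1 - 8 * n * ε * (t - r₀)) (-(8 * n * ε)) s := by
    have := (((hasDerivAt_id s).sub_const r₀).const_mul (8 * n * ε)).const_sub 1
    exact this.congr_deriv (by simp)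
  exact HasTwoDerivAt.of_forall h₁ h₂

theorem hasTwoDerivAt_one_sub_sq (s : ℝ) :
    HasTwoDerivAt (fun t => 1 - t ^ 2) (-(2 * s)) (-2) s := by
  have h₁ : ∀ t : ℝ, HasDerivAt (fun t : ℝ => 1 - t ^ 2) (-(2 * t)) t := fun t =>
    ((hasDerivAt_pow 2 t).const_sub 1).congr_deriv (by simp)
  have h₂ : HasDerivAt (fun t : ℝ => -(2 * t)) (-2) s :=
    (((hasDerivAt_id s).const_mul 2).neg).congr_deriv (by simp)
  exact HasTwoDerivAt.of_forall h₁ h₂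

/-- The constants governing all comparison arguments: `f(t) + K t` is nondecreasing, `f ≥ 0`
beyond `a`, and the annulus `r₀ ≤ ‖x‖ < 1` is thin. -/
structure ThinAnnulus (N : ℕ) (f : ℝ → ℝ) (a K r₀ : ℝ) : Prop where
  one_le : 1 ≤ N
  nonneg : ∀ t, a < t → 0 ≤ f t
  K_nonneg : 0 ≤ K
  le_add : ∀ s t, s ≤ t → f s ≤ f t + K * (t - s)
  thin : 64 * N * (1 - r₀) ≤ 1
  K_thin : K * (1 - r₀) ≤ 1 / 4
  lt_one : r₀ < 1

theorem ThinAnnulus.one_le_cast (h : ThinAnnulus N f a K r₀) : (1 : ℝ) ≤ N := by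
  exact_mod_cast h.one_le

theorem ThinAnnulus.le_radius (h : ThinAnnulus N f a K r₀) : 63 / 64 ≤ r₀ := by
  nlinarith [h.one_le_cast, h.thin, h.lt_one]

end LargeSolutions

section SphericalComparison

open scoped Topology

variable {N : ℕ} {f : ℝ → ℝ} {a K r₀ : ℝ} {u v : EuclideanSpace ℝ (Fin N) → ℝ}

/-- The arithmetic behind `reparam_touching_false`: `P₁, P₂` and `Q₁, Q₂` are the radial
derivatives of the two solutions, `p` and `q` the values of the nonlinearity. -/
theorem touching_arithmetic_false {n K r₀ s ε A P₁ P₂ Q₁ Q₂ p q η : ℝ} (hn : 1 ≤ n)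
    (hK : 0 ≤ K) (hthin : 64 * n * (1 - r₀) ≤ 1) (hKthin : K * (1 - r₀) ≤ 1 / 4)
    (hr₀ : 63 / 64 ≤ r₀) (hs : r₀ ≤ s) (hs1 : s < 1) (hε : 0 < ε) (hε1 : ε ≤ 1) (hA : 0 < A)
    (hP : 0 ≤ P₁) (hq : 0 ≤ q)
    (hd₁ : P₁ - Q₁ * (1 - 8 * n * ε * (s - r₀)) + 2 * A * s = 0)
    (hd₂ : P₂ - (Q₂ * (1 - 8 * n * ε * (s - r₀)) ^ 2 + Q₁ * -(8 * n * ε)) + 2 * A ≤ 0)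
    (hp : p ≤ P₂ + (n - 1) / s * P₁) (hq' : Q₂ + (n - 1) / η * Q₁ ≤ q)
    (hmono : q ≤ p + K * (A * (1 - s ^ 2)))
    (hbr : -(8 * n * ε) + (n - 1) / s * (1 - 8 * n * ε * (s - r₀))
      - (n - 1) / η * (1 - 8 * n * ε * (s - r₀)) ^ 2 ≤ 0) : False := by
  have hs0 : 0 < s := by linarith
  have hNs : (0 : ℝ) ≤ n * (s - r₀) := mul_nonneg (by linarith) (by linarith)
  have hNs' : n * (s - r₀) ≤ 1 / 64 := by nlinarith
  have he0 : 0 < 1 - 8 * n * ε * (s - r₀) := by nlinarith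
  have he1 : 1 - 8 * n * ε * (s - r₀) ≤ 1 := by nlinarith
  generalize 1 - 8 * n * ε * (s - r₀) = e₁ at *
  have hQe : Q₁ * e₁ = P₁ + 2 * A * s := by linarith
  have hQ1 : 0 ≤ Q₁ := by
    by_contra! hneg
    have : Q₁ * e₁ < 0 := mul_neg_of_neg_of_pos hneg he0
    have : 0 < A * s := mul_pos hA hs0
    linarith
  have hns : (n - 1) / s * s = n - 1 := by field_simp
  have hb := mul_nonpos_of_nonneg_of_nonpos hQ1 hbr
  have hsq := mul_le_mul_of_nonneg_left hq' (sq_nonneg e₁)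
  have hsq1 : e₁ ^ 2 * q ≤ q := mul_le_of_le_one_left hq (by nlinarith)
  have hP1eq : (n - 1) / s * P₁ = (n - 1) / s * Q₁ * e₁ - 2 * A * (n - 1) := by
    have : P₁ = Q₁ * e₁ - 2 * A * s := by linarith
    rw [this]
    linear_combination (-2 * A) * hns
  have hfin : p ≤ q - 2 * n * A := by linarith
  have hKA : K * (1 - s ^ 2) ≤ 1 / 2 := by
    have h1 : 1 - s ^ 2 ≤ 2 * (1 - r₀) := by nlinarith
    have := mul_le_mul_of_nonneg_left h1 hK
    linarith
  have : K * (A * (1 - s ^ 2)) ≤ A * (1 / 2) := by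
    rw [mul_left_comm]; exact mul_le_mul_of_nonneg_left hKA hA.le
  have : A ≤ n * A := le_mul_of_one_le_left hA.le hn
  linarith

/-- The comparison at a touching point: `u(r ω₁) - v(η(r) ω₂) - A (1 - r²)` cannot have a zero
local maximum if `ω₁` is a maximum point of `u` and `ω₂` is a minimum point of `v` on the
respective spheres. -/
theorem reparam_touching_false (h : ThinAnnulus N f a K r₀) (hu : BlowsUpAbove f a r₀ u)
    (hv : BlowsUpAbove f a r₀ v) {ε s A : ℝ} {ω₁ ω₂ : EuclideanSpace ℝ (Fin N)}
    {η : ℝ → ℝ} (hη : η = fun t => t + ε * (1 - 4 * N * (t - r₀) ^ 2))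
    (hε : 0 < ε) (hε1 : ε ≤ 1) (hs : r₀ < s) (hηs : s ≤ η s) (hη1 : η s < 1) (hA : 0 < A)
    (hω₁ : ‖ω₁‖ = 1) (hω₂ : ‖ω₂‖ = 1)
    (hmax : ∀ ω, ‖ω‖ = 1 → u (s • ω) ≤ u (s • ω₁))
    (hmin : ∀ ω, ‖ω‖ = 1 → v (η s • ω₂) ≤ v (η s • ω))
    (heq : u (s • ω₁) - v (η s • ω₂) = A * (1 - s ^ 2))
    (hloc : IsLocalMax (fun t => u (t • ω₁) - v (η t • ω₂) - A * (1 - t ^ 2)) s) : False := by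
  have hN := h.one_le_cast
  have hr₀ := h.le_radius
  have hs0 : 0 < s := by linarith
  have hs1 : s < 1 := by linarith
  have hη0 : 0 < η s := by linarith
  have hnu : ‖s • ω₁‖ = s := by rw [norm_smul, hω₁, mul_one, Real.norm_of_nonneg hs0.le]
  have hnv : ‖η s • ω₂‖ = η s := by rw [norm_smul, hω₂, mul_one, Real.norm_of_nonneg hη0.le]
  have hcu := hu.contDiffAt (s • ω₁) (by rw [hnu]; exact hs1)
  have hcv := hv.contDiffAt (η s • ω₂) (by rw [hnv]; exact hη1)
  have hp := hasTwoDerivAt_ray hcu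
  have hq := hasTwoDerivAt_ray hcv
  have hηd : HasTwoDerivAt η (1 - 8 * N * ε * (s - r₀)) (-(8 * N * ε)) s := by
    rw [hη]; exact hasTwoDerivAt_reparam N r₀ ε s
  have hd := ((hp.sub (hq.comp hηd)).sub
    ((hasTwoDerivAt_one_sub_sq s).const_mul A)).of_isLocalMax hloc
  have hlu := lapl_le_of_isMaxOn_sphere h.one_le hs0 hω₁ hcu hmax
  have hlv := le_lapl_of_isMinOn_sphere h.one_le hη0 hω₂ hcv hmin
  rw [hu.lapl_eq _ (by rw [hnu]; exact hs1)] at hlu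
  rw [hv.lapl_eq _ (by rw [hnv]; exact hη1)] at hlv
  have hP1 : 0 ≤ fderiv ℝ u (s • ω₁) ω₁ := by
    obtain ⟨p', hp', hp1, -⟩ := hp
    have hg : HasDerivAt (fun t : ℝ => u ((s - t) • ω₁) - u (s • ω₁))
        (-fderiv ℝ u (s • ω₁) ω₁) 0 := by
      have h1 : HasDerivAt (fun t : ℝ => s - t) (-1) 0 := by
        simpa using (hasDerivAt_id (0 : ℝ)).const_sub s
      have h2 : HasDerivAt (fun t : ℝ => u (t • ω₁)) (p' s) (s - 0) := by
        rw [sub_zero]; exact hp'.self_of_nhds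
      have := (h2.comp 0 h1).sub_const (u (s • ω₁))
      rw [hp1] at this
      exact this.congr_deriv (by ring)
    have := hg.le_of_eventually_le (C := 0) (by simp) (by
      filter_upwards [Ioo_mem_nhdsGT hs0] with t ht
      rw [zero_mul, sub_nonpos]
      refine hu.le_of_le_sphere h.one_le h.nonneg hs1 (hu.gt _ ?_ ?_).le ?_ _ ?_
      · rw [hnu]; exact hs.le
      · rw [hnu]; exact hs1
      · intro x hx
        have hx0 : x = s • (s⁻¹ • x) := by rw [smul_smul, mul_inv_cancel₀ hs0.ne', one_smul]
        rw [hx0]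
        refine hmax _ ?_
        rw [norm_smul, hx, norm_inv, Real.norm_of_nonneg hs0.le, inv_mul_cancel₀ hs0.ne']
      · rw [norm_smul, hω₁, mul_one, Real.norm_of_nonneg (by linarith [ht.2])]
        linarith [ht.1])
    linarith
  have hfv : 0 ≤ f (v (η s • ω₂)) := h.nonneg _ (hv.gt _ (by rw [hnv]; linarith)
    (by rw [hnv]; exact hη1))
  have hle : v (η s • ω₂) ≤ u (s • ω₁) := by
    have : 0 ≤ A * (1 - s ^ 2) := mul_nonneg hA.le (by nlinarith)
    linarith
  have hmono := h.le_add _ _ hle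
  rw [heq] at hmono
  have hbr := reparam_bracket_nonpos hN hr₀ h.thin hε hε1 hs.le hs1.le (congrFun hη s)
  obtain ⟨hd1, hd2⟩ := hd
  exact touching_arithmetic_false hN h.K_nonneg h.thin h.K_thin hr₀ hs.le hs1 hε hε1 hA hP1 hfv
    (by linarith) (by linarith) hlu hlv hmono hbr

theorem reparam_comparison (h : ThinAnnulus N f a K r₀) (hu : BlowsUpAbove f a r₀ u)
    (hv : BlowsUpAbove f a r₀ v) {C ε r : ℝ} {ω₁ ω₂ : EuclideanSpace ℝ (Fin N)} {η : ℝ → ℝ}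
    (hη : η = fun t => t + ε * (1 - 4 * N * (t - r₀) ^ 2)) (hC : 0 ≤ C)
    (hCu : ∀ x, ‖x‖ = r₀ → u x - a ≤ C * (1 - r₀ ^ 2))
    (hε : 0 < ε) (hε1 : ε ≤ 1) (hr : r₀ ≤ r) (hr1 : r ≤ 1) (hηr : η r < 1)
    (hω₁ : ‖ω₁‖ = 1) (hω₂ : ‖ω₂‖ = 1) :
    u (r • ω₁) - v (η r • ω₂) ≤ C * (1 - r ^ 2) := by
  have hN := h.one_le_cast
  have hr₀ := h.le_radius
  have hshift : ∀ t, r₀ ≤ t → t ≤ 1 → t + ε / 2 ≤ η t := fun t ht ht1 => by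
    have h1 : (N : ℝ) * (t - r₀) ≤ 1 / 64 := by nlinarith [h.thin]
    have h2 : (N : ℝ) * (t - r₀) * (t - r₀) ≤ 1 / 64 * 1 :=
      mul_le_mul h1 (by linarith) (by linarith) (by norm_num)
    rw [hη]; simp only; nlinarith
  by_contra! hlt
  obtain ⟨B, hB⟩ := hu.exists_le (r := 1 - ε / 2) (by linarith)
  obtain ⟨r', hr', hvB⟩ := hv.blowup B
  set ρ := max r' (η r) with hρ
  have hρ1 : ρ < 1 := max_lt hr' hηr
  let T : Set (ℝ × EuclideanSpace ℝ (Fin N) × EuclideanSpace ℝ (Fin N)) :=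
    (Icc r₀ 1 ∩ {t | η t ≤ ρ}) ×ˢ sphere 0 1 ×ˢ sphere 0 1
  have hηc : Continuous η := by rw [hη]; fun_prop
  have hT : IsCompact T := (isCompact_Icc.inter_right (isClosed_le hηc continuous_const)).prod
    ((isCompact_sphere _ _).prod (isCompact_sphere _ _))
  have hT' : ∀ z ∈ T, r₀ ≤ z.1 ∧ z.1 + ε / 2 ≤ η z.1 ∧ η z.1 ≤ ρ ∧ ‖z.2.1‖ = 1 ∧ ‖z.2.2‖ = 1 :=
    fun z hz => ⟨hz.1.1.1, hshift _ hz.1.1.1 hz.1.1.2, hz.1.2, by simpa using hz.2.1,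
      by simpa using hz.2.2⟩
  have hnorm : ∀ (t : ℝ) (ω : EuclideanSpace ℝ (Fin N)), r₀ ≤ t → ‖ω‖ = 1 → ‖t • ω‖ = t :=
    fun t ω ht hω => by rw [norm_smul, hω, mul_one, Real.norm_of_nonneg (by linarith)]
  have hden : ∀ z ∈ T, 0 < 1 - z.1 ^ 2 := fun z hz => by
    obtain ⟨h1, h2, h3, -⟩ := hT' z hz
    nlinarith
  have hcont : ContinuousOn (fun z : ℝ × EuclideanSpace ℝ (Fin N) × EuclideanSpace ℝ (Fin N) =>
      (u (z.1 • z.2.1) - v (η z.1 • z.2.2)) / (1 - z.1 ^ 2)) T := by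
    refine ContinuousOn.div (ContinuousOn.sub ?_ ?_) (by fun_prop) fun z hz => (hden z hz).ne'
    · refine hu.continuousOn.comp (by fun_prop) fun z hz => ?_
      obtain ⟨h1, h2, h3, h4, h5⟩ := hT' z hz
      rw [mem_ball_zero_iff, hnorm _ _ h1 h4]
      linarith
    · refine hv.continuousOn.comp (by fun_prop) fun z hz => ?_
      obtain ⟨h1, h2, h3, h4, h5⟩ := hT' z hz
      rw [mem_ball_zero_iff, hnorm _ _ (by linarith) h5]
      linarith
  have hmem : (r, ω₁, ω₂) ∈ T := ⟨⟨⟨hr, hr1⟩, le_max_right r' (η r)⟩, by simpa using hω₁,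
    by simpa using hω₂⟩
  obtain ⟨⟨s, b₁, b₂⟩, hsT, hmax⟩ := hT.exists_isMaxOn ⟨_, hmem⟩ hcont
  obtain ⟨hs, hηs, hηρ, hb₁, hb₂⟩ := hT' _ hsT
  simp only at hs hηs hηρ hb₁ hb₂
  have hs1 : s < 1 := by linarith
  set A := (u (s • b₁) - v (η s • b₂)) / (1 - s ^ 2) with hAdef
  have hdens : 0 < 1 - s ^ 2 := hden _ hsT
  have heq : u (s • b₁) - v (η s • b₂) = A * (1 - s ^ 2) := by
    rw [hAdef, div_mul_cancel₀ _ hdens.ne']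
  have hle : ∀ z ∈ T, u (z.1 • z.2.1) - v (η z.1 • z.2.2) ≤ A * (1 - z.1 ^ 2) := fun z hz =>
    (div_le_iff₀ (hden z hz)).1 (hmax hz)
  have hCA : C < A := by
    have := hle _ hmem
    simp only at this
    have h2 : 0 < 1 - r ^ 2 := hden _ hmem
    by_contra! h3
    nlinarith
  have hA : 0 < A := hC.trans_lt hCA
  have hpos : 0 < A * (1 - s ^ 2) := mul_pos hA hdens
  have hsr : r₀ < s := by
    refine lt_of_le_of_ne hs fun hsr => ?_
    have h1 := hCu (s • b₁) (by rw [hnorm _ _ hs hb₁, hsr])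
    have h2 := hv.gt (η s • b₂) (by rw [hnorm _ _ (by linarith) hb₂]; linarith)
      (by rw [hnorm _ _ (by linarith) hb₂]; linarith)
    rw [hsr] at h1
    nlinarith
  have hηlt : η s < r' := by
    by_contra! hge
    have h1 := hB (s • b₁) (by rw [hnorm _ _ hs hb₁]; linarith)
    have h2 := hvB (η s • b₂) (by rwa [hnorm _ _ (by linarith) hb₂])
      (by rw [hnorm _ _ (by linarith) hb₂]; linarith)
    linarith
  refine reparam_touching_false h hu hv hη hε hε1 hsr (by linarith) (by linarith) hA hb₁ hb₂
    (fun ω hω => ?_) (fun ω hω => ?_) heq ?_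
  · have := hle (s, ω, b₂) ⟨hsT.1, by simpa using hω, hsT.2.2⟩
    simp only at this
    linarith
  · have := hle (s, b₁, ω) ⟨hsT.1, hsT.2.1, by simpa using hω⟩
    simp only at this
    linarith
  · have hηnear : ∀ᶠ t in 𝓝 s, η t < r' := hηc.continuousAt.eventually (gt_mem_nhds hηlt)
    filter_upwards [hηnear, Ioo_mem_nhds hsr hs1] with t ht1 ht2
    have := hle (t, b₁, b₂) ⟨⟨⟨ht2.1.le, ht2.2.le⟩, ht1.le.trans (le_max_left _ _)⟩, hsT.2⟩
    simp only at this
    rw [heq]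
    linarith

/-- Two large solutions differ by at most a multiple of the distance to the boundary, even after
an independent rotation of each of them. -/
theorem exists_sphere_sub_le (h : ThinAnnulus N f a K r₀) (hu : BlowsUpAbove f a r₀ u)
    (hv : BlowsUpAbove f a r₀ v) :
    ∃ C, 0 ≤ C ∧ ∀ (r : ℝ) (ω₁ ω₂ : EuclideanSpace ℝ (Fin N)), r₀ ≤ r → r < 1 → ‖ω₁‖ = 1 →
      ‖ω₂‖ = 1 → u (r • ω₁) - v (r • ω₂) ≤ C * (1 - r ^ 2) := by
  have hN := h.one_le_cast
  have hr₀ := h.le_radius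
  obtain ⟨B, hB⟩ := hu.exists_le h.lt_one
  have hden : 0 < 1 - r₀ ^ 2 := by nlinarith [h.lt_one]
  refine ⟨max (B - a) 0 / (1 - r₀ ^ 2), by positivity, fun r ω₁ ω₂ hr hr1 hω₁ hω₂ => ?_⟩
  set c := 1 - 4 * (N : ℝ) * (r - r₀) ^ 2 with hc
  have hlim : Tendsto (fun ε : ℝ => u (r • ω₁) - v ((r + ε * c) • ω₂)) (𝓝[>] 0)
      (𝓝 (u (r • ω₁) - v (r • ω₂))) := by
    have hvc := (hv.contDiffAt (r • ω₂) (by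
      rw [norm_smul, hω₂, mul_one, Real.norm_of_nonneg (by linarith)]; exact hr1)).continuousAt
    have hl : Tendsto (fun ε : ℝ => (r + ε * c) • ω₂) (𝓝[>] 0) (𝓝 (r • ω₂)) := by
      have : Continuous fun ε : ℝ => (r + ε * c) • ω₂ := by fun_prop
      simpa using (this.tendsto 0).mono_left nhdsWithin_le_nhds
    exact tendsto_const_nhds.sub (hvc.tendsto.comp hl)
  refine le_of_tendsto hlim ?_
  have hsmall : ∀ᶠ ε : ℝ in 𝓝[>] 0, r + ε * c < 1 := by
    have : Continuous fun ε : ℝ => r + ε * c := by fun_prop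
    refine ((this.tendsto 0).mono_left nhdsWithin_le_nhds).eventually (gt_mem_nhds ?_)
    simpa using hr1
  filter_upwards [hsmall, Ioo_mem_nhdsGT one_pos] with ε hε1 hε
  refine reparam_comparison h hu hv rfl (by positivity) (fun x hx => ?_) hε.1 hε.2.le hr hr1.le
    hε1 hω₁ hω₂
  rw [div_mul_cancel₀ _ hden.ne']
  exact (sub_le_sub_right (hB x hx.le) a).trans (le_max_left _ _)

end SphericalComparison

section SphericalOscillation

open scoped Topology

variable {N : ℕ} {f : ℝ → ℝ} {a K r₀ : ℝ} {u : Bool → EuclideanSpace ℝ (Fin N) → ℝ}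

/-- The difference between the largest and the smallest value taken on the sphere of radius `r` by
the two functions `u false` and `u true`. -/
noncomputable def sphereOsc (u : Bool → EuclideanSpace ℝ (Fin N) → ℝ) (r : ℝ) : ℝ :=
  sSup (range fun z : (Bool × sphere (0 : EuclideanSpace ℝ (Fin N)) 1) ×
    (Bool × sphere (0 : EuclideanSpace ℝ (Fin N)) 1) =>
      u z.1.1 (r • (z.1.2 : EuclideanSpace ℝ (Fin N)))
        - u z.2.1 (r • (z.2.2 : EuclideanSpace ℝ (Fin N))))

theorem continuous_spherical_values (hu : ∀ i, BlowsUpAbove f a r₀ (u i)) :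
    Continuous fun p : Ico (0 : ℝ) 1 ×
      (Bool × sphere (0 : EuclideanSpace ℝ (Fin N)) 1) =>
        u p.2.1 ((p.1 : ℝ) • (p.2.2 : EuclideanSpace ℝ (Fin N))) := by
  have h₁ : ContinuousOn (fun q : Bool × EuclideanSpace ℝ (Fin N) => u q.1 q.2)
      (univ ×ˢ ball 0 1) := by
    rw [continuousOn_prod_of_discrete_left]
    intro i
    exact (hu i).continuousOn.mono fun x hx => hx.2
  refine h₁.comp_continuous (f := fun p : Ico (0 : ℝ) 1 ×
      (Bool × sphere (0 : EuclideanSpace ℝ (Fin N)) 1) =>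
      (p.2.1, (p.1 : ℝ) • (p.2.2 : EuclideanSpace ℝ (Fin N)))) (by fun_prop) fun p => ?_
  refine ⟨mem_univ _, ?_⟩
  have h₂ : ‖(p.2.2 : EuclideanSpace ℝ (Fin N))‖ = 1 := by simp
  rw [mem_ball_zero_iff, norm_smul, h₂, mul_one, Real.norm_of_nonneg p.1.2.1]
  exact p.1.2.2

theorem continuous_spherical_differences (hu : ∀ i, BlowsUpAbove f a r₀ (u i)) :
    Continuous fun p : Ico (0 : ℝ) 1 × ((Bool × sphere (0 : EuclideanSpace ℝ (Fin N)) 1) ×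
      (Bool × sphere (0 : EuclideanSpace ℝ (Fin N)) 1)) =>
        u p.2.1.1 ((p.1 : ℝ) • (p.2.1.2 : EuclideanSpace ℝ (Fin N)))
          - u p.2.2.1 ((p.1 : ℝ) • (p.2.2.2 : EuclideanSpace ℝ (Fin N))) := by
  have h := continuous_spherical_values hu
  have h₁ := h.comp (f := fun p : Ico (0 : ℝ) 1 ×
    ((Bool × sphere (0 : EuclideanSpace ℝ (Fin N)) 1) ×
      (Bool × sphere (0 : EuclideanSpace ℝ (Fin N)) 1)) => (p.1, p.2.1)) (by fun_prop)
  have h₂ := h.comp (f := fun p : Ico (0 : ℝ) 1 ×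
    ((Bool × sphere (0 : EuclideanSpace ℝ (Fin N)) 1) ×
      (Bool × sphere (0 : EuclideanSpace ℝ (Fin N)) 1)) => (p.1, p.2.2)) (by fun_prop)
  exact h₁.sub h₂

theorem continuousOn_sphereOsc (hu : ∀ i, BlowsUpAbove f a r₀ (u i)) :
    ContinuousOn (sphereOsc u) (Ico 0 1) := by
  rw [continuousOn_iff_continuous_domRestrict]
  have h := IsCompact.continuous_sSup isCompact_univ
    (f := fun (r : Ico (0 : ℝ) 1) (z : (Bool × sphere (0 : EuclideanSpace ℝ (Fin N)) 1) ×
      (Bool × sphere (0 : EuclideanSpace ℝ (Fin N)) 1)) =>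
        u z.1.1 ((r : ℝ) • (z.1.2 : EuclideanSpace ℝ (Fin N)))
          - u z.2.1 ((r : ℝ) • (z.2.2 : EuclideanSpace ℝ (Fin N))))
    (continuous_spherical_differences hu)
  simp only [image_univ] at h
  exact h

theorem isCompact_spherical_differences (hu : ∀ i, BlowsUpAbove f a r₀ (u i)) {r : ℝ}
    (hr : 0 ≤ r) (hr1 : r < 1) :
    IsCompact (range fun z : (Bool × sphere (0 : EuclideanSpace ℝ (Fin N)) 1) ×
    (Bool × sphere (0 : EuclideanSpace ℝ (Fin N)) 1) =>
      u z.1.1 (r • (z.1.2 : EuclideanSpace ℝ (Fin N)))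
        - u z.2.1 (r • (z.2.2 : EuclideanSpace ℝ (Fin N)))) :=
  isCompact_range ((continuous_spherical_differences hu).comp
    (f := fun z => ((⟨r, hr, hr1⟩ : Ico (0 : ℝ) 1), z)) (by fun_prop))

theorem sub_le_sphereOsc_smul (hu : ∀ i, BlowsUpAbove f a r₀ (u i)) {r : ℝ} (hr : 0 ≤ r)
    (hr1 : r < 1) (i j : Bool) {ω₁ ω₂ : EuclideanSpace ℝ (Fin N)} (hω₁ : ‖ω₁‖ = 1)
    (hω₂ : ‖ω₂‖ = 1) : u i (r • ω₁) - u j (r • ω₂) ≤ sphereOsc u r :=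
  le_csSup (isCompact_spherical_differences hu hr hr1).bddAbove
    ⟨((i, ⟨ω₁, by simpa using hω₁⟩), (j, ⟨ω₂, by simpa using hω₂⟩)), rfl⟩

theorem exists_sphereOsc_eq_smul (hN : 1 ≤ N) (hu : ∀ i, BlowsUpAbove f a r₀ (u i)) {r : ℝ}
    (hr : 0 ≤ r) (hr1 : r < 1) :
    ∃ (i j : Bool) (ω₁ ω₂ : EuclideanSpace ℝ (Fin N)), ‖ω₁‖ = 1 ∧ ‖ω₂‖ = 1 ∧
      sphereOsc u r = u i (r • ω₁) - u j (r • ω₂) := by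
  have hne : Nonempty (sphere (0 : EuclideanSpace ℝ (Fin N)) 1) :=
    ⟨⟨EuclideanSpace.single ⟨0, hN⟩ 1, by simp⟩⟩
  obtain ⟨⟨⟨i, ω₁⟩, ⟨j, ω₂⟩⟩, hz⟩ :=
    (isCompact_spherical_differences hu hr hr1).sSup_mem (range_nonempty _)
  exact ⟨i, j, ω₁, ω₂, by simp, by simp, hz.symm⟩

theorem norm_smul_unit {ω : EuclideanSpace ℝ (Fin N)} {r : ℝ} (hr : 0 ≤ r) (hω : ‖ω‖ = 1) :
    ‖r • ω‖ = r := by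
  rw [norm_smul, hω, mul_one, Real.norm_of_nonneg hr]

theorem eq_smul_unit {x : EuclideanSpace ℝ (Fin N)} (hx : 0 < ‖x‖) :
    ∃ ω, ‖ω‖ = 1 ∧ x = ‖x‖ • ω :=
  ⟨‖x‖⁻¹ • x, by rw [norm_smul, norm_inv, norm_norm, inv_mul_cancel₀ hx.ne'],
    by rw [smul_smul, mul_inv_cancel₀ hx.ne', one_smul]⟩

theorem sub_le_sphereOsc (hu : ∀ i, BlowsUpAbove f a r₀ (u i)) {r : ℝ} (hr : 0 < r)
    (hr1 : r < 1) (i j : Bool) {x y : EuclideanSpace ℝ (Fin N)} (hx : ‖x‖ = r)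
    (hy : ‖y‖ = r) : u i x - u j y ≤ sphereOsc u r := by
  obtain ⟨ω₁, h₁, hx'⟩ := eq_smul_unit (hx ▸ hr)
  obtain ⟨ω₂, h₂, hy'⟩ := eq_smul_unit (hy ▸ hr)
  rw [hx', hy', hx, hy]
  exact sub_le_sphereOsc_smul hu hr.le hr1 i j h₁ h₂

theorem sphereOsc_nonneg (hN : 1 ≤ N) (hu : ∀ i, BlowsUpAbove f a r₀ (u i)) {r : ℝ}
    (hr : 0 ≤ r) (hr1 : r < 1) : 0 ≤ sphereOsc u r := by
  have h1 : ‖EuclideanSpace.single (⟨0, hN⟩ : Fin N) (1 : ℝ)‖ = 1 := by simp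
  simpa using sub_le_sphereOsc_smul hu hr hr1 true true h1 h1

theorem exists_sphereOsc_le (h : ThinAnnulus N f a K r₀)
    (hu : ∀ i, BlowsUpAbove f a r₀ (u i)) :
    ∃ C, 0 ≤ C ∧ ∀ r, r₀ ≤ r → r < 1 → sphereOsc u r ≤ C * (1 - r ^ 2) := by
  choose C hC0 hC using fun p : Bool × Bool => exists_sphere_sub_le h (hu p.1) (hu p.2)
  refine ⟨∑ p, C p, Finset.sum_nonneg fun p _ => hC0 p, fun r hr hr1 => ?_⟩
  have hr0 : 0 ≤ r := by linarith [h.le_radius]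
  obtain ⟨i, j, ω₁, ω₂, h₁, h₂, heq⟩ := exists_sphereOsc_eq_smul h.one_le hu hr0 hr1
  rw [heq]
  refine (hC (i, j) r ω₁ ω₂ hr hr1 h₁ h₂).trans (mul_le_mul_of_nonneg_right ?_ (by nlinarith))
  exact Finset.single_le_sum (fun p _ => hC0 p) (Finset.mem_univ (i, j))

/-- `sphereOsc u` satisfies `G'' + (N - 1) / r G' ≥ -K G` in the viscosity sense. -/
theorem sphereOsc_touching (h : ThinAnnulus N f a K r₀)
    (hu : ∀ i, BlowsUpAbove f a r₀ (u i)) {P : ℝ → ℝ} {P₁ P₂ s : ℝ} (hs : 0 < s) (hs1 : s < 1)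
    (hP : HasTwoDerivAt P P₁ P₂ s) (hloc : IsLocalMax (fun t => sphereOsc u t - P t) s) :
    -(K * sphereOsc u s) ≤ P₂ + (N - 1) / s * P₁ := by
  obtain ⟨i, j, ω₁, ω₂, h₁, h₂, heq⟩ := exists_sphereOsc_eq_smul h.one_le hu hs.le hs1
  have hc₁ := (hu i).contDiffAt (s • ω₁) (by rwa [norm_smul_unit hs.le h₁])
  have hc₂ := (hu j).contDiffAt (s • ω₂) (by rwa [norm_smul_unit hs.le h₂])
  have hd := (((hasTwoDerivAt_ray hc₁).sub (hasTwoDerivAt_ray hc₂)).sub hP).of_isLocalMax (by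
    filter_upwards [hloc, Ioo_mem_nhds hs hs1] with t ht ht'
    have := sub_le_sphereOsc_smul hu ht'.1.le ht'.2 i j h₁ h₂
    rw [← heq]
    linarith)
  have hl₁ := lapl_le_of_isMaxOn_sphere h.one_le hs h₁ hc₁ (fun ω hω => by
    have := sub_le_sphereOsc_smul hu hs.le hs1 i j hω h₂
    linarith)
  have hl₂ := le_lapl_of_isMinOn_sphere h.one_le hs h₂ hc₂ (fun ω hω => by
    have := sub_le_sphereOsc_smul hu hs.le hs1 i j h₁ hω
    linarith)
  rw [(hu i).lapl_eq _ (by rwa [norm_smul_unit hs.le h₁])] at hl₁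
  rw [(hu j).lapl_eq _ (by rwa [norm_smul_unit hs.le h₂])] at hl₂
  have hmono := h.le_add _ _ (sub_nonneg.1 (heq ▸ sphereOsc_nonneg h.one_le hu hs.le hs1))
  rw [← heq] at hmono
  have hP1 : P₁ = fderiv ℝ (u i) (s • ω₁) ω₁ - fderiv ℝ (u j) (s • ω₂) ω₂ := by
    linarith [hd.1]
  rw [hP1, mul_sub]
  linarith [hd.2]

theorem sphereOsc_comparison (h : ThinAnnulus N f a K r₀)
    (hu : ∀ i, BlowsUpAbove f a r₀ (u i)) {P P₁ P₂ : ℝ → ℝ} {s₀ s₁ : ℝ} (hs₀ : 0 < s₀)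
    (hs₁ : s₁ < 1) (hP : ∀ t, HasTwoDerivAt P (P₁ t) (P₂ t) t)
    (hsuper : ∀ t, s₀ < t → t < s₁ → P₂ t + (N - 1) / t * P₁ t < -(K * sphereOsc u t))
    (h₀ : sphereOsc u s₀ ≤ P s₀) (h₁ : sphereOsc u s₁ ≤ P s₁) (t : ℝ) (ht₀ : s₀ ≤ t)
    (ht₁ : t ≤ s₁) : sphereOsc u t ≤ P t := by
  have hPc : Continuous P := continuous_iff_continuousAt.2 fun t => by
    obtain ⟨p, hp, -⟩ := hP t
    exact hp.self_of_nhds.continuousAt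
  obtain ⟨s, hs, hmax⟩ := isCompact_Icc.exists_isMaxOn (f := fun t => sphereOsc u t - P t)
    ⟨t, ht₀, ht₁⟩ (((continuousOn_sphereOsc hu).mono fun t ht =>
      ⟨hs₀.le.trans ht.1, ht.2.trans_lt hs₁⟩).sub hPc.continuousOn)
  have hts : sphereOsc u t - P t ≤ sphereOsc u s - P s := hmax ⟨ht₀, ht₁⟩
  rcases hs.1.eq_or_lt with rfl | hs0
  · linarith
  rcases hs.2.eq_or_lt with rfl | hs1
  · linarith
  have := sphereOsc_touching h hu (hs₀.trans hs0) (hs1.trans hs₁) (hP s)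
    (hmax.isLocalMax (Icc_mem_nhds hs0 hs1))
  linarith [hsuper s hs0 hs1]

/-- Lower bound on the slope of `sphereOsc u`. -/
theorem exists_sphereOsc_le_add_left (h : ThinAnnulus N f a K r₀)
    (hu : ∀ i, BlowsUpAbove f a r₀ (u i)) :
    ∃ L, 0 ≤ L ∧ ∀ s t, (1 + r₀) / 2 ≤ t → t < 1 → r₀ ≤ s → s ≤ t →
      sphereOsc u s ≤ sphereOsc u t + L * (t - s) := by
  obtain ⟨C, hC0, hC⟩ := exists_sphereOsc_le h hu
  have hr₀ := h.le_radius
  have hr1 := h.lt_one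
  have hN := h.one_le_cast
  have hK := h.K_nonneg
  set D := ((1 + r₀) / 2) ^ 2 - r₀ ^ 2 with hD
  have hD0 : 0 < D := by rw [hD]; nlinarith
  have hD1 : D ≤ 1 := by rw [hD]; nlinarith
  set A := (C + K * C + 1) / D with hA
  have hKC : 0 ≤ K * C := mul_nonneg hK hC0
  have hAD : A * D = C + K * C + 1 := div_mul_cancel₀ _ hD0.ne'
  have hA0 : 0 < A := by positivity
  have hA1 : C + K * C + 1 ≤ A := by nlinarith
  refine ⟨2 * A, by positivity, fun s t ht ht1 hs hst => ?_⟩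
  have hcomp := sphereOsc_comparison h hu (P := fun x => sphereOsc u t + A * (t ^ 2 - x ^ 2))
    (P₁ := fun x => -(2 * A * x)) (P₂ := fun _ => -(2 * A)) (s₀ := r₀) (s₁ := t)
    (by linarith) ht1 (fun x => ?_) (fun x hx0 hx1 => ?_) ?_ (by simp) s hs hst
  · refine hcomp.trans ?_
    have : t ^ 2 - s ^ 2 ≤ 2 * (t - s) := by nlinarith
    nlinarith
  · have h₁ : ∀ x : ℝ, HasDerivAt (fun x : ℝ => sphereOsc u t + A * (t ^ 2 - x ^ 2))
        (-(2 * A * x)) x := fun x =>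
      (((hasDerivAt_pow 2 x).const_sub (t ^ 2)).const_mul A |>.const_add _).congr_deriv
        (by simp; ring)
    exact HasTwoDerivAt.of_forall h₁
      (((hasDerivAt_id x).const_mul (2 * A)).neg.congr_deriv (by simp))
  · have hx : (N - 1) / x * -(2 * A * x) = -(2 * A * (N - 1)) := by
      have : x ≠ 0 := by linarith
      field_simp
    rw [hx]
    have h1 := mul_le_mul_of_nonneg_left (hC x hx0.le (by linarith)) hK
    have h2 : K * C * x ^ 2 ≥ 0 := by positivity
    nlinarith
  · have h1 := hC r₀ le_rfl hr1
    have h2 := sphereOsc_nonneg h.one_le hu (by linarith : 0 ≤ t) ht1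
    have h3 : D ≤ t ^ 2 - r₀ ^ 2 := by rw [hD]; nlinarith
    have h4 := mul_le_mul_of_nonneg_left h3 hA0.le
    nlinarith [sq_nonneg r₀]

theorem barrier_bracket_le {n x r₀ : ℝ} (hn : 1 ≤ n)
    (hthin : 64 * n * (1 - r₀) ≤ 1) (hx : r₀ ≤ x) (hx1 : x ≤ 1) :
    2 + 2 * n * (1 - 3 * x ^ 2) + (n - 1) * (2 + 2 * n * (1 - x ^ 2)) ≤ -1 := by
  have h₁ : 1 - x ^ 2 ≤ 2 * (1 - r₀) := by nlinarith
  have h₂ : n * (1 - x ^ 2) ≤ 1 / 32 := by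
    have := mul_le_mul_of_nonneg_left h₁ (by linarith : 0 ≤ n)
    linarith
  have h₃ := mul_le_mul_of_nonneg_left h₂ (by linarith : 0 ≤ 4 + 2 * n)
  linarith

/-- Upper bound on the slope of `sphereOsc u`. -/
theorem exists_sphereOsc_le_add_right (h : ThinAnnulus N f a K r₀)
    (hu : ∀ i, BlowsUpAbove f a r₀ (u i)) :
    ∃ L, 0 ≤ L ∧ ∀ s t, r₀ ≤ s → s ≤ t → t < 1 →
      sphereOsc u t ≤ sphereOsc u s + L * (t - s) := by
  obtain ⟨C, hC0, hC⟩ := exists_sphereOsc_le h hu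
  have hr₀ := h.le_radius
  have hr1 := h.lt_one
  have hN := h.one_le_cast
  have hK := h.K_nonneg
  have hKC : 0 ≤ K * C := mul_nonneg hK hC0
  set A := C + K * C + 1 with hA
  have hA0 : 0 < A := by positivity
  refine ⟨2 * A * (1 + N), by positivity, fun s t hs hst ht1 => ?_⟩
  have hG0 := sphereOsc_nonneg h.one_le hu (by linarith : 0 ≤ s) (hst.trans_lt ht1)
  set P : ℝ → ℝ := fun x => sphereOsc u s
    + A * (x ^ 2 - s ^ 2 + N / 2 * ((1 - s ^ 2) ^ 2 - (1 - x ^ 2) ^ 2)) with hPdef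
  have hPlow : ∀ x, s ≤ x → x ≤ 1 → sphereOsc u s + A * (x ^ 2 - s ^ 2) ≤ P x := by
    intro x hx hx1
    have h1 : x ^ 2 ≤ 1 := by nlinarith
    have h2 : s ^ 2 ≤ x ^ 2 := by nlinarith
    have h3 : 0 ≤ (N : ℝ) / 2 * ((1 - s ^ 2) ^ 2 - (1 - x ^ 2) ^ 2) :=
      mul_nonneg (by positivity) (by nlinarith)
    rw [hPdef]; simp only; nlinarith
  have hPup : P t ≤ sphereOsc u s + 2 * A * (1 + N) * (t - s) := by
    have h1 : t ^ 2 ≤ 1 := by nlinarith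
    have h2 : 0 ≤ t ^ 2 - s ^ 2 := by nlinarith
    have h3 : (1 - s ^ 2) ^ 2 - (1 - t ^ 2) ^ 2 ≤ 2 * (t ^ 2 - s ^ 2) := by nlinarith
    have h4 : (N : ℝ) / 2 * ((1 - s ^ 2) ^ 2 - (1 - t ^ 2) ^ 2) ≤ N * (t ^ 2 - s ^ 2) := by
      nlinarith
    have h5 : t ^ 2 - s ^ 2 ≤ 2 * (t - s) := by nlinarith
    have h6 : (1 + (N : ℝ)) * (t ^ 2 - s ^ 2) ≤ (1 + N) * (2 * (t - s)) :=
      mul_le_mul_of_nonneg_left h5 (by positivity)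
    rw [hPdef]; simp only; nlinarith
  have hfar : ∀ x, s ≤ x → x < 1 → 2 * (1 - x ^ 2) ≤ 1 - s ^ 2 → sphereOsc u x ≤ P x := by
    intro x hx hx1 hx2
    have h1 := hC x (by linarith) hx1
    have h2 := hPlow x hx hx1.le
    have h3 : C * (1 - x ^ 2) ≤ A * (x ^ 2 - s ^ 2) :=
      mul_le_mul (by linarith) (by linarith) (by nlinarith) hA0.le
    linarith
  rcases le_total (2 * (1 - t ^ 2)) (1 - s ^ 2) with hcase | hcase
  · exact (hfar t hst ht1 hcase).trans hPup
  set s₁ := Real.sqrt ((1 + s ^ 2) / 2) with hs₁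
  have hs₁sq : s₁ ^ 2 = (1 + s ^ 2) / 2 := Real.sq_sqrt (by positivity)
  have hs₁0 : 0 ≤ s₁ := Real.sqrt_nonneg _
  have hs1 : s < 1 := by linarith
  have hs0 : 0 < s := by linarith
  have hs₁1 : s₁ < 1 := by nlinarith
  have hts₁ : t ≤ s₁ := by nlinarith
  refine (sphereOsc_comparison h hu (P := P)
    (P₁ := fun x => A * (2 * x + 2 * N * x * (1 - x ^ 2)))
    (P₂ := fun x => A * (2 + 2 * N * (1 - 3 * x ^ 2))) hs0 hs₁1 (fun x => ?_)
    (fun x hx0 hx1 => ?_) (by simp [hPdef]) (hfar s₁ (hst.trans hts₁) hs₁1 (by linarith)) t hst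
    hts₁).trans hPup
  · have h₁ : ∀ x : ℝ, HasDerivAt P (A * (2 * x + 2 * N * x * (1 - x ^ 2))) x := fun x => by
      have h2 := (((hasDerivAt_pow 2 x).const_sub 1).pow 2).const_sub ((1 - s ^ 2) ^ 2)
      have h3 := ((hasDerivAt_pow 2 x).sub_const (s ^ 2)).add (h2.const_mul ((N : ℝ) / 2))
      exact ((h3.const_mul A).const_add (sphereOsc u s)).congr_deriv (by simp [-mul_eq_mul_left_iff]; ring)
    have h₂ : HasDerivAt (fun x : ℝ => A * (2 * x + 2 * N * x * (1 - x ^ 2)))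
        (A * (2 + 2 * N * (1 - 3 * x ^ 2))) x := by
      have h4 := ((hasDerivAt_id x).const_mul (2 * (N : ℝ))).mul
        ((hasDerivAt_pow 2 x).const_sub 1)
      exact ((((hasDerivAt_id x).const_mul 2).add h4).const_mul A).congr_deriv (by simp [-mul_eq_mul_left_iff]; ring)
    exact HasTwoDerivAt.of_forall h₁ h₂
  · have hx : (N - 1) / x * (A * (2 * x + 2 * N * x * (1 - x ^ 2)))
        = A * ((N - 1) * (2 + 2 * N * (1 - x ^ 2))) := by
      have : x ≠ 0 := by linarith
      field_simp
    rw [hx]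
    have h1 := mul_le_mul_of_nonneg_left (hC x (by linarith) (by linarith)) hK
    have h2 : K * C * x ^ 2 ≥ 0 := by positivity
    have h3 := mul_le_mul_of_nonneg_left (barrier_bracket_le hN h.thin (by linarith : r₀ ≤ x)
      (by linarith)) hA0.le
    linarith

theorem exists_sphereOsc_lipschitz (h : ThinAnnulus N f a K r₀)
    (hu : ∀ i, BlowsUpAbove f a r₀ (u i)) :
    ∃ L, 0 ≤ L ∧ ∀ s t, (1 + r₀) / 2 ≤ s → s ≤ t → t < 1 →
      |sphereOsc u s - sphereOsc u t| ≤ L * (t - s) := by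
  obtain ⟨L₁, h₁0, h₁⟩ := exists_sphereOsc_le_add_left h hu
  obtain ⟨L₂, h₂0, h₂⟩ := exists_sphereOsc_le_add_right h hu
  refine ⟨L₁ + L₂, by positivity, fun s t hs hst ht => ?_⟩
  have hr : r₀ ≤ s := by linarith [h.lt_one]
  have h3 := h₁ s t (hs.trans hst) ht hr hst
  have h4 := h₂ s t hr hst ht
  have h5 := mul_nonneg h₁0 (sub_nonneg.2 hst)
  have h6 := mul_nonneg h₂0 (sub_nonneg.2 hst)
  rw [abs_le]
  constructor <;> linarith

end SphericalOscillation

section TangentialDerivative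

open scoped Topology RealInnerProductSpace

variable {N : ℕ} {f : ℝ → ℝ} {a K r₀ : ℝ} {F G : EuclideanSpace ℝ (Fin N) → ℝ}
  {L M : ℝ} {x : EuclideanSpace ℝ (Fin N)}

/-- `F` is twice differentiable at `x` along the coordinate lines, and its second derivatives add
up to `L`. -/
def HasLaplAt (F : EuclideanSpace ℝ (Fin N) → ℝ) (L : ℝ) (x : EuclideanSpace ℝ (Fin N)) : Prop :=
  ∃ d₁ d₂ : Fin N → ℝ, (∀ i, HasTwoDerivAt
    (fun t : ℝ => F (x + t • EuclideanSpace.single i (1 : ℝ))) (d₁ i) (d₂ i) 0) ∧ ∑ i, d₂ i = L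

theorem HasLaplAt.add (hF : HasLaplAt F L x) (hG : HasLaplAt G M x) :
    HasLaplAt (fun y => F y + G y) (L + M) x := by
  obtain ⟨d₁, d₂, h, rfl⟩ := hF
  obtain ⟨e₁, e₂, h', rfl⟩ := hG
  exact ⟨_, _, fun i => (h i).add (h' i), Finset.sum_add_distrib⟩

theorem HasLaplAt.sub (hF : HasLaplAt F L x) (hG : HasLaplAt G M x) :
    HasLaplAt (fun y => F y - G y) (L - M) x := by
  obtain ⟨d₁, d₂, h, rfl⟩ := hF
  obtain ⟨e₁, e₂, h', rfl⟩ := hG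
  exact ⟨_, _, fun i => (h i).sub (h' i), Finset.sum_sub_distrib _ _⟩

theorem HasLaplAt.const_mul (c : ℝ) (hF : HasLaplAt F L x) :
    HasLaplAt (fun y => c * F y) (c * L) x := by
  obtain ⟨d₁, d₂, h, rfl⟩ := hF
  exact ⟨_, _, fun i => (h i).const_mul c, (Finset.mul_sum _ _ _).symm⟩

theorem HasLaplAt.nonpos_of_isLocalMax (hF : HasLaplAt F L x) (hmax : IsLocalMax F x) :
    L ≤ 0 := by
  obtain ⟨d₁, d₂, h, rfl⟩ := hF
  exact Finset.sum_nonpos fun i _ => ((h i).of_isLocalMax (isLocalMax_line hmax _)).2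

theorem hasLaplAt_comp {u : EuclideanSpace ℝ (Fin N) → ℝ}
    {T : EuclideanSpace ℝ (Fin N) → EuclideanSpace ℝ (Fin N)}
    {R : EuclideanSpace ℝ (Fin N) ≃ₗᵢ[ℝ] EuclideanSpace ℝ (Fin N)}
    (hT : ∀ v, T (x + v) = T x + R v) (hu : ContDiffAt ℝ 2 u (T x)) :
    HasLaplAt (fun y => u (T y)) (lapl u (T x)) x := by
  refine ⟨fun i => fderiv ℝ u (T x) (R (EuclideanSpace.single i 1)), _, fun i => ?_,
    (lapl_eq_sum_isometry R).symm⟩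
  simpa [hT] using hasTwoDerivAt_line hu (R (EuclideanSpace.single i 1))

theorem inner_add_smul_single (x ν : EuclideanSpace ℝ (Fin N)) (i : Fin N) (t : ℝ) :
    ⟪x + t • EuclideanSpace.single i (1 : ℝ), ν⟫ = ⟪x, ν⟫ + ν i * t := by
  rw [inner_add_left, inner_smul_left, EuclideanSpace.inner_single_left]
  simp [mul_comm]

theorem inner_eq_sum_mul (x ν : EuclideanSpace ℝ (Fin N)) : ⟪x, ν⟫ = ∑ i, ν i * x i := by
  simp [PiLp.inner_apply]

theorem hasLaplAt_barrier (A σ q : ℝ) (ν x : EuclideanSpace ℝ (Fin N)) :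
    HasLaplAt (fun y => (A * ⟪y, ν⟫ + σ) * (q - ‖y‖ ^ 2))
      (-(2 * N * (A * ⟪x, ν⟫ + σ)) - 4 * A * ⟪x, ν⟫) x := by
  refine ⟨fun i => A * ν i * (q - ‖x‖ ^ 2) - 2 * (A * ⟪x, ν⟫ + σ) * x i, fun i => 2 * (-(A * ⟪x, ν⟫ + σ) - 2 * A * (ν i * x i)), fun i => ?_, ?_⟩
  · have h := hasTwoDerivAt_cubic ((A * ⟪x, ν⟫ + σ) * (q - ‖x‖ ^ 2))
      (A * ν i * (q - ‖x‖ ^ 2) - 2 * (A * ⟪x, ν⟫ + σ) * x i)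
      (-(A * ⟪x, ν⟫ + σ) - 2 * A * (ν i * x i)) (-(A * ν i))
    convert h using 2 with t
    simp only [norm_add_smul_single_sq, inner_add_smul_single]
    ring
  · rw [← Finset.mul_sum, Finset.sum_sub_distrib, ← Finset.mul_sum, ← inner_eq_sum_mul]
    simp
    ring

theorem reflection_orthogonal_singleton {ν : EuclideanSpace ℝ (Fin N)} (hν : ‖ν‖ = 1)
    (x : EuclideanSpace ℝ (Fin N)) : (ℝ ∙ ν)ᗮ.reflection x = x - (2 * ⟪x, ν⟫) • ν := by
  rw [Submodule.reflection_orthogonal_apply, Submodule.reflection_singleton_apply, hν,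
    real_inner_comm]
  simp only [RCLike.ofReal_real_eq_id, id, one_pow, div_one]
  module

theorem BlowsUpAbove.exists_norm_fderiv_le {u : EuclideanSpace ℝ (Fin N) → ℝ}
    (hu : BlowsUpAbove f a r₀ u) {r : ℝ} (hr : r < 1) :
    ∃ L, 0 ≤ L ∧ ∀ x, ‖x‖ ≤ r → ‖fderiv ℝ u x‖ ≤ L := by
  have hc : ContinuousOn (fun x => ‖fderiv ℝ u x‖) (closedBall 0 r) := fun x hx => by
    have hx1 : ‖x‖ < 1 := (mem_closedBall_zero_iff.1 hx).trans_lt hr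
    have := ((hu.contDiffAt x hx1).fderiv_right (m := 1) (by norm_num)).continuousAt
    exact this.norm.continuousWithinAt
  obtain ⟨L, hL⟩ := (isCompact_closedBall (0 : EuclideanSpace ℝ (Fin N)) r).bddAbove_image hc
  refine ⟨max L 0, le_max_right _ _, fun x hx => le_max_of_le_left ?_⟩
  exact hL (mem_image_of_mem _ (mem_closedBall_zero_iff.2 hx))

theorem BlowsUpAbove.exists_sub_le {u : EuclideanSpace ℝ (Fin N) → ℝ}
    (hu : BlowsUpAbove f a r₀ u) {r : ℝ} (hr : r < 1) :
    ∃ L, 0 ≤ L ∧ ∀ x y, ‖x‖ ≤ r → ‖y‖ ≤ r → u x - u y ≤ L * ‖x - y‖ := by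
  obtain ⟨L, hL0, hL⟩ := hu.exists_norm_fderiv_le hr
  refine ⟨L, hL0, fun x y hx hy => (le_abs_self _).trans ?_⟩
  rw [← Real.norm_eq_abs]
  exact (convex_closedBall (0 : EuclideanSpace ℝ (Fin N)) r).norm_image_sub_le_of_norm_fderiv_le
    (𝕜 := ℝ) (fun z hz => (hu.contDiffAt z ((mem_closedBall_zero_iff.1 hz).trans_lt
      hr)).differentiableAt (by norm_num)) (fun z hz => hL z (mem_closedBall_zero_iff.1 hz))
    (mem_closedBall_zero_iff.2 hy) (mem_closedBall_zero_iff.2 hx)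

/-- Comparison of a solution with its reflection, on a spherical half-shell. -/
theorem sub_reflection_le_barrier {u : EuclideanSpace ℝ (Fin N) → ℝ} (h : ThinAnnulus N f a K r₀)
    (hu : BlowsUpAbove f a r₀ u) {L σ r : ℝ} (hL0 : 0 ≤ L)
    (hL : ∀ x y, ‖x‖ ≤ r₀ → ‖y‖ ≤ r₀ → u x - u y ≤ L * ‖x - y‖) (hσ : 0 < σ) (hr1 : r < 1)
    (hr : ∀ x y, ‖x‖ = r → ‖y‖ = r → u x - u y ≤ σ * (1 - r₀))
    {ν : EuclideanSpace ℝ (Fin N)} (hν : ‖ν‖ = 1) (x : EuclideanSpace ℝ (Fin N))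
    (hx : r₀ ≤ ‖x‖) (hxr : ‖x‖ ≤ r) (hxν : 0 ≤ ⟪x, ν⟫) :
    u x - u ((ℝ ∙ ν)ᗮ.reflection x)
      ≤ (2 * L / (1 - r₀) * ⟪x, ν⟫ + σ) * (2 - r₀ - ‖x‖ ^ 2) := by
  have hr₀ := h.le_radius
  have hr₀1 := h.lt_one
  have hδ : 0 < 1 - r₀ := by linarith
  set R := (ℝ ∙ ν)ᗮ.reflection with hR
  set A := 2 * L / (1 - r₀) with hA
  have hA0 : 0 ≤ A := by positivity
  have hAδ : A * (1 - r₀) = 2 * L := div_mul_cancel₀ _ hδ.ne'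
  set b : EuclideanSpace ℝ (Fin N) → ℝ := fun y => (A * ⟪y, ν⟫ + σ) * (2 - r₀ - ‖y‖ ^ 2) with hb
  set S : Set (EuclideanSpace ℝ (Fin N)) := {y | r₀ ≤ ‖y‖ ∧ ‖y‖ ≤ r ∧ 0 ≤ ⟪y, ν⟫} with hS
  have hin : Continuous fun y : EuclideanSpace ℝ (Fin N) => ⟪y, ν⟫ := by fun_prop
  have hScl : IsClosed S := (isClosed_le continuous_const continuous_norm).inter
    ((isClosed_le continuous_norm continuous_const).inter
      (isClosed_le continuous_const hin))
  have hScpt : IsCompact S := (isCompact_closedBall 0 r).of_isClosed_subset hScl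
    fun y hy => mem_closedBall_zero_iff.2 hy.2.1
  have hψ : ∀ y ∈ S, 1 - r₀ ≤ 2 - r₀ - ‖y‖ ^ 2 := fun y hy => by
    nlinarith [hy.2.1, norm_nonneg y]
  have hp : ∀ y ∈ S, σ ≤ A * ⟪y, ν⟫ + σ := fun y hy => by
    linarith [mul_nonneg hA0 hy.2.2]
  have hbδ : ∀ y ∈ S, (A * ⟪y, ν⟫ + σ) * (1 - r₀) ≤ b y := fun y hy =>
    mul_le_mul_of_nonneg_left (hψ y hy) (hσ.le.trans (hp y hy))
  have hb0 : ∀ y ∈ S, 0 < b y := fun y hy =>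
    (mul_pos (hσ.trans_le (hp y hy)) hδ).trans_le (hbδ y hy)
  have huc : ContinuousOn (fun y => u y - u (R y)) S := fun y hy => by
    have hy1 : ‖y‖ < 1 := hy.2.1.trans_lt hr1
    have h₁ := (hu.contDiffAt y hy1).continuousAt
    have h₂ := (hu.contDiffAt (R y) (by rwa [R.norm_map])).continuousAt
    exact (h₁.sub (h₂.comp R.continuous.continuousAt)).continuousWithinAt
  have hbc : ContinuousOn b S := by rw [hb]; fun_prop
  obtain ⟨z, hz, hmax⟩ := hScpt.exists_isMaxOn ⟨x, hx, hxr, hxν⟩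
    (huc.div hbc fun y hy => (hb0 y hy).ne')
  set s := (u z - u (R z)) / b z with hs
  have hvle : ∀ y ∈ S, u y - u (R y) ≤ s * b y := fun y hy =>
    (div_le_iff₀ (hb0 y hy)).1 (hmax hy)
  have hvz : u z - u (R z) = s * b z := (div_mul_cancel₀ _ (hb0 z hz).ne').symm
  suffices hs1 : s ≤ 1 from
    (hvle x ⟨hx, hxr, hxν⟩).trans (mul_le_of_le_one_left (hb0 x ⟨hx, hxr, hxν⟩).le hs1)
  by_contra! hs1
  have hgt : b z < u z - u (R z) := by rw [hvz]; nlinarith [hb0 z hz]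
  have hRz := reflection_orthogonal_singleton hν z
  have hz0 : 0 < ⟪z, ν⟫ := hz.2.2.lt_of_ne fun h0 => by
    rw [← h0] at hRz
    rw [← hR] at hRz
    rw [hRz] at hgt
    have := hb0 z hz
    simp at hgt
    linarith
  have hzr₀ : r₀ < ‖z‖ := hz.1.lt_of_ne fun h0 => by
    have h1 := hL z (R z) h0.ge (by rw [R.norm_map, h0])
    have h2 : ‖z - R z‖ = 2 * ⟪z, ν⟫ := by
      rw [hR, hRz, sub_sub_cancel, norm_smul, hν, mul_one, Real.norm_of_nonneg (by linarith)]
    rw [h2] at h1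
    have h3 := hbδ z hz
    nlinarith
  have hzr : ‖z‖ < r := hz.2.1.lt_of_ne fun h0 => by
    have h1 := hr z (R z) h0 (by rw [R.norm_map, h0])
    have h3 := hbδ z hz
    have h4 := mul_le_mul_of_nonneg_right (hp z hz) hδ.le
    linarith
  have hz1 : ‖z‖ < 1 := hzr.trans hr1
  have hnhds : S ∈ 𝓝 z := by
    have h1 : ∀ᶠ y in 𝓝 z, r₀ < ‖y‖ := continuous_norm.continuousAt.eventually_const_lt hzr₀
    have h2 : ∀ᶠ y in 𝓝 z, ‖y‖ < r := continuous_norm.continuousAt.eventually_lt_const hzr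
    have h3 : ∀ᶠ y in 𝓝 z, 0 < ⟪y, ν⟫ := 
      hin.continuousAt.eventually_const_lt hz0
    filter_upwards [h1, h2, h3] with y hy1 hy2 hy3 using ⟨hy1.le, hy2.le, hy3.le⟩
  have hloc : IsLocalMax (fun y => u y - u (R y) - s * b y) z := by
    filter_upwards [hnhds] with y hy
    linarith [hvle y hy]
  have hlapl := (((hasLaplAt_comp (T := id) (R := LinearIsometryEquiv.refl ℝ _) (by simp)
    (hu.contDiffAt z hz1)).sub (hasLaplAt_comp (T := R) (R := R) (by simp)
    (hu.contDiffAt (R z) (by rwa [R.norm_map])))).sub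
    ((hasLaplAt_barrier A σ (2 - r₀) ν z).const_mul s)).nonpos_of_isLocalMax hloc
  simp only [id] at hlapl
  rw [hu.lapl_eq z hz1, hu.lapl_eq (R z) (by rwa [R.norm_map])] at hlapl
  have hmono := h.le_add (u (R z)) (u z) (by linarith [hb0 z hz])
  rw [hvz] at hmono
  have hK : K * (2 - r₀ - ‖z‖ ^ 2) ≤ 1 := by
    have h1 : 2 - r₀ - ‖z‖ ^ 2 ≤ 3 * (1 - r₀) := by nlinarith
    have h2 := mul_le_mul_of_nonneg_left h1 h.K_nonneg
    linarith [h.K_thin]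
  have hpz := hp z hz
  have h1 := mul_le_mul_of_nonneg_left hK (hσ.le.trans hpz)
  have h2 := mul_le_mul_of_nonneg_right h.one_le_cast (hσ.le.trans hpz)
  have h3 : K * b z < 2 * N * (A * ⟪z, ν⟫ + σ) + 4 * A * ⟪z, ν⟫ := by
    have h4 : 0 ≤ A * ⟪z, ν⟫ := mul_nonneg hA0 hz0.le
    have h5 : K * b z = (A * ⟪z, ν⟫ + σ) * (K * (2 - r₀ - ‖z‖ ^ 2)) := by rw [hb]; ring
    linarith
  have h6 := mul_lt_mul_of_pos_left h3 (by linarith : 0 < s)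
  linarith

theorem exists_sub_reflection_le {u : EuclideanSpace ℝ (Fin N) → ℝ} (h : ThinAnnulus N f a K r₀)
    (hu : BlowsUpAbove f a r₀ u) :
    ∃ A, 0 ≤ A ∧ ∀ ν x, ‖ν‖ = 1 → r₀ ≤ ‖x‖ → ‖x‖ < 1 → 0 ≤ ⟪x, ν⟫ →
      u x - u ((ℝ ∙ ν)ᗮ.reflection x) ≤ A * ⟪x, ν⟫ := by
  have hr₀ := h.le_radius
  have hδ : 0 < 1 - r₀ := by linarith [h.lt_one]
  obtain ⟨L, hL0, hL⟩ := hu.exists_sub_le h.lt_one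
  obtain ⟨C, hC0, hC⟩ := exists_sphere_sub_le h hu hu
  have hA0 : 0 ≤ 2 * L / (1 - r₀) := by positivity
  refine ⟨2 * (2 * L / (1 - r₀)), by positivity, fun ν x hν hx hx1 hxν => ?_⟩
  have key : ∀ σ, 0 < σ → u x - u ((ℝ ∙ ν)ᗮ.reflection x)
      ≤ (2 * L / (1 - r₀) * ⟪x, ν⟫ + σ) * (2 - r₀ - ‖x‖ ^ 2) := by
    intro σ hσ
    set τ := σ * (1 - r₀) / (2 * (C + 1)) with hτ
    have hτ0 : 0 < τ := by positivity
    have hτe : τ * (2 * (C + 1)) = σ * (1 - r₀) := div_mul_cancel₀ _ (by positivity)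
    have hr1 : max ‖x‖ (1 - τ) < 1 := max_lt hx1 (by linarith)
    set r := max ‖x‖ (1 - τ) with hr
    have hxr : ‖x‖ ≤ r := le_max_left _ _
    have hτr : 1 - τ ≤ r := le_max_right _ _
    have hr0 : 0 < r := by linarith
    refine sub_reflection_le_barrier h hu hL0 hL hσ hr1 (fun y z hy hz => ?_) hν x hx hxr hxν
    obtain ⟨ω₁, h₁, hy'⟩ := eq_smul_unit (hy ▸ hr0)
    obtain ⟨ω₂, h₂, hz'⟩ := eq_smul_unit (hz ▸ hr0)
    rw [hy', hz', hy, hz]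
    refine (hC r ω₁ ω₂ (hx.trans hxr) hr1 h₁ h₂).trans ?_
    have h3 : 1 - r ^ 2 ≤ 2 * τ := by nlinarith
    have h4 := mul_le_mul_of_nonneg_left h3 hC0
    linarith
  refine le_of_forall_pos_le_add fun ε hε => (key (ε / 2) (half_pos hε)).trans ?_
  have h1 : 2 - r₀ - ‖x‖ ^ 2 ≤ 2 := by nlinarith [sq_nonneg ‖x‖]
  have h2 := mul_nonneg hA0 hxν
  have h3 := mul_le_mul_of_nonneg_left h1 (by linarith :
    0 ≤ 2 * L / (1 - r₀) * ⟪x, ν⟫ + ε / 2)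
  linarith

theorem exists_fderiv_tangential_le {u : EuclideanSpace ℝ (Fin N) → ℝ}
    (h : ThinAnnulus N f a K r₀) (hu : BlowsUpAbove f a r₀ u) :
    ∃ A, 0 ≤ A ∧ ∀ ν x, ‖ν‖ = 1 → r₀ ≤ ‖x‖ → ‖x‖ < 1 → ⟪x, ν⟫ = 0 → fderiv ℝ u x ν ≤ A := by
  obtain ⟨A, hA0, hA⟩ := exists_sub_reflection_le h hu
  refine ⟨A, hA0, fun ν x hν hx hx1 hxν => ?_⟩
  have hd := (hu.contDiffAt x hx1).differentiableAt (by norm_num)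
  have hline : ∀ w : EuclideanSpace ℝ (Fin N),
      HasDerivAt (fun t : ℝ => u (x + t • w)) (fderiv ℝ u x w) 0 := fun w =>
    hd.hasFDerivAt.hasLineDerivAt w
  have hder := (hline ν).sub (hline (-ν))
  have hin : ∀ t : ℝ, ⟪x + t • ν, ν⟫ = t := fun t => by
    rw [inner_add_left, hxν, inner_smul_left, real_inner_self_eq_norm_sq, hν]
    simp
  have hev : ∀ᶠ t : ℝ in 𝓝[>] 0, ‖x + t • ν‖ < 1 := by
    refine eventually_nhdsWithin_of_eventually_nhds ?_
    have hc : ContinuousAt (fun t : ℝ => ‖x + t • ν‖) 0 := by fun_prop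
    exact hc.eventually_lt_const (by simpa using hx1)
  have := HasDerivAt.le_of_eventually_le (C := A) hder (by simp) (by
    filter_upwards [hev, self_mem_nhdsWithin] with t ht (ht0 : 0 < t)
    have h1 : ‖x‖ ≤ ‖x + t • ν‖ := by
      have : ‖x + t • ν‖ ^ 2 = ‖x‖ ^ 2 + t ^ 2 := by
        rw [norm_add_sq_real, inner_smul_right, hxν, norm_smul, hν]
        simp
      nlinarith [norm_nonneg x, norm_nonneg (x + t • ν), sq_nonneg t]
    have h2 := hA ν (x + t • ν) hν (hx.trans h1) ht (by rw [hin]; exact ht0.le)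
    rw [reflection_orthogonal_singleton hν, hin] at h2
    have h3 : x + t • ν - (2 * t) • ν = x + t • -ν := by module
    rw [h3] at h2
    exact h2)
  rw [map_neg] at this
  linarith

end TangentialDerivative

section RadialDerivative

open scoped Topology RealInnerProductSpace

variable {N : ℕ} {f : ℝ → ℝ} {a K r₀ : ℝ} {u : Bool → EuclideanSpace ℝ (Fin N) → ℝ}

theorem hasLaplAt_saddle (κ A r : ℝ) {e : EuclideanSpace ℝ (Fin N)} (he : ‖e‖ = 1)
    (x : EuclideanSpace ℝ (Fin N)) :
    HasLaplAt (fun y => κ * (‖y - r • e‖ ^ 2 - (N + 2) * (⟪y, e⟫ - r) ^ 2) + A * (⟪y, e⟫ - r))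
      (-(4 * κ)) x := by
  refine ⟨fun i => κ * (2 * (x - r • e) i - (N + 2) * (2 * (⟪x, e⟫ - r) * e i)) + A * e i,
    fun i => 2 * (κ * (1 - (N + 2) * (e i * e i))), fun i => ?_, ?_⟩
  · have h := hasTwoDerivAt_cubic
      (κ * (‖x - r • e‖ ^ 2 - (N + 2) * (⟪x, e⟫ - r) ^ 2) + A * (⟪x, e⟫ - r))
      (κ * (2 * (x - r • e) i - (N + 2) * (2 * (⟪x, e⟫ - r) * e i)) + A * e i)
      (κ * (1 - (N + 2) * (e i * e i))) 0
    convert h using 2 with t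
    simp only [add_sub_right_comm x, norm_add_smul_single_sq, inner_add_smul_single]
    ring
  · rw [← Finset.mul_sum, ← Finset.mul_sum, Finset.sum_sub_distrib, ← Finset.mul_sum,
      ← inner_eq_sum_mul, real_inner_self_eq_norm_sq, he]
    simp
    ring

theorem exists_sphereOsc_eq_isometry (h : ThinAnnulus N f a K r₀)
    (hu : ∀ i, BlowsUpAbove f a r₀ (u i)) {y : EuclideanSpace ℝ (Fin N)} (hy : 0 < ‖y‖)
    (hy1 : ‖y‖ < 1) :
    ∃ (i j : Bool) (R₁ R₂ : EuclideanSpace ℝ (Fin N) ≃ₗᵢ[ℝ] EuclideanSpace ℝ (Fin N)),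
      sphereOsc u ‖y‖ = u i (R₁ y) - u j (R₂ y) ∧
      ∀ k l, -(2 * K * sphereOsc u ‖y‖)
        ≤ f (u i (R₁ y)) - f (u j (R₂ y)) + (f (u k y) - f (u l y)) := by
  obtain ⟨i, j, ω₁, ω₂, h₁, h₂, heq⟩ := exists_sphereOsc_eq_smul h.one_le hu hy.le hy1
  obtain ⟨R₁, hR₁⟩ := exists_isometry_map_eq (norm_smul_unit hy.le h₁).symm
  obtain ⟨R₂, hR₂⟩ := exists_isometry_map_eq (norm_smul_unit hy.le h₂).symm
  rw [← hR₁, ← hR₂] at heq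
  refine ⟨i, j, R₁, R₂, heq, fun k l => ?_⟩
  have hle : ∀ i j x z, ‖x‖ = ‖y‖ → ‖z‖ = ‖y‖ → u i x - u j z ≤ sphereOsc u ‖y‖ :=
    fun i j x z hx hz => sub_le_sphereOsc hu hy hy1 i j hx hz
  have h3 := hle l j y (R₂ y) rfl (R₂.norm_map y)
  have h4 := hle i k (R₁ y) y (R₁.norm_map y) rfl
  have h5 := hle i l (R₁ y) y (R₁.norm_map y) rfl
  have h6 := hle k j y (R₂ y) rfl (R₂.norm_map y)
  have h7 := h.le_add (u l y) (u i (R₁ y)) (by linarith)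
  have h8 := h.le_add (u j (R₂ y)) (u k y) (by linarith)
  have h9 := mul_le_mul_of_nonneg_left h5 h.K_nonneg
  have h10 := mul_le_mul_of_nonneg_left h6 h.K_nonneg
  linarith

/-- Reflection of the difference of two solutions across the hyperplane tangent to a sphere. -/
theorem sub_tangentReflection_le (h : ThinAnnulus N f a K r₀)
    (hu : ∀ i, BlowsUpAbove f a r₀ (u i)) {C L A r : ℝ} (hC0 : 0 ≤ C)
    (hC : ∀ s, r₀ ≤ s → s < 1 → sphereOsc u s ≤ C * (1 - s ^ 2)) (hL0 : 0 ≤ L)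
    (hL : ∀ s t, (1 + r₀) / 2 ≤ s → s ≤ t → t < 1 →
      |sphereOsc u s - sphereOsc u t| ≤ L * (t - s))
    (hA : 2 * L + 24 * C + 6 * (K * C) + 1 ≤ A) (hr : 1 - r ≤ (1 - r₀) / 3) (hr1 : r < 1)
    {e : EuclideanSpace ℝ (Fin N)} (he : ‖e‖ = 1) (y : EuclideanSpace ℝ (Fin N))
    (hy : ‖y - r • e‖ ≤ (1 - r) / 2) (hye : r ≤ ⟪y, e⟫) :
    u true y - u false y
      - (u true ((ℝ ∙ e)ᗮ.reflection y + (2 * r) • e)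
        - u false ((ℝ ∙ e)ᗮ.reflection y + (2 * r) • e))
      + (sphereOsc u ‖y‖ + sphereOsc u ‖(ℝ ∙ e)ᗮ.reflection y + (2 * r) • e‖
        - 2 * sphereOsc u r)
      ≤ A / ((1 - r) / 2) * (‖y - r • e‖ ^ 2 - (N + 2) * (⟪y, e⟫ - r) ^ 2)
        + A * (N + 2) * (⟪y, e⟫ - r) := by
  have hr₀ := h.le_radius
  have hr₀1 := h.lt_one
  have hK := h.K_nonneg
  have hKC : 0 ≤ K * C := mul_nonneg hK hC0
  set ρ := (1 - r) / 2 with hρ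
  have hρ0 : 0 < ρ := by linarith
  have hρ1 : ρ ≤ 1 := by linarith
  have hr0 : 0 < r := by linarith
  set κ := A / ρ with hκ
  have hA0 : 0 < A := by linarith
  have hκρ : κ * ρ = A := div_mul_cancel₀ _ hρ0.ne'
  have hκ0 : 0 < κ := by positivity
  have hκA : A ≤ κ := by nlinarith
  set R := (ℝ ∙ e)ᗮ.reflection with hR
  set σ : EuclideanSpace ℝ (Fin N) → EuclideanSpace ℝ (Fin N) := fun y => R y + (2 * r) • e
    with hσ
  have hσeq : ∀ y, σ y = y - (2 * (⟪y, e⟫ - r)) • e := fun y => by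
    simp only [hσ, hR]
    rw [reflection_orthogonal_singleton he]
    module
  have hσadd : ∀ y v, σ (y + v) = σ y + R v := fun y v => by
    simp only [hσ, map_add]
    abel
  have hσnorm : ∀ y, ‖σ y - r • e‖ = ‖y - r • e‖ := fun y => by
    have h1 : σ y - r • e = R (y - r • e) := by
      have h2 : R e = -e := by
        rw [hR, reflection_orthogonal_singleton he, real_inner_self_eq_norm_sq, he]
        module
      simp only [hσ, map_sub, map_smul, h2]
      module
    rw [h1, R.norm_map]
  have hσc : Continuous σ := by simp only [hσ]; fun_prop
  have hin : Continuous fun y : EuclideanSpace ℝ (Fin N) => ⟪y, e⟫ := by fun_prop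
  have hre : ‖r • e‖ = r := norm_smul_unit hr0.le he
  have hball : ∀ y, ‖y - r • e‖ ≤ ρ → (1 + r₀) / 2 ≤ ‖y‖ ∧ ‖y‖ < 1 ∧ 1 - ‖y‖ ≤ 3 * ρ := by
    intro y hy
    have h1 := norm_sub_norm_le y (r • e)
    have h2 := norm_sub_norm_le (r • e) y
    rw [norm_sub_rev] at h2
    rw [hre] at h1 h2
    exact ⟨by linarith, by linarith, by linarith⟩
  have hG : ∀ y, ‖y - r • e‖ ≤ ρ → sphereOsc u ‖y‖ ≤ 6 * C * ρ := by
    intro y hy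
    obtain ⟨h1, h2, h3⟩ := hball y hy
    have h4 : 1 - ‖y‖ ^ 2 ≤ 6 * ρ := by nlinarith
    have h5 := mul_le_mul_of_nonneg_left h4 hC0
    linarith [hC ‖y‖ (by linarith) h2]
  set S : Set (EuclideanSpace ℝ (Fin N)) := {y | ‖y - r • e‖ ≤ ρ ∧ r ≤ ⟪y, e⟫} with hS
  have hScpt : IsCompact S := by
    refine (isCompact_closedBall (r • e) ρ).of_isClosed_subset ?_ fun y hy => ?_
    · have hd : Continuous fun y : EuclideanSpace ℝ (Fin N) => ‖y - r • e‖ := by fun_prop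
      exact (isClosed_le hd continuous_const).inter (isClosed_le continuous_const hin)
    · rw [mem_closedBall, dist_eq_norm]; exact hy.1
  set P : EuclideanSpace ℝ (Fin N) → ℝ := fun y =>
    κ * (‖y - r • e‖ ^ 2 - (N + 2) * (⟪y, e⟫ - r) ^ 2) + A * (N + 2) * (⟪y, e⟫ - r) with hP
  set Ξ : EuclideanSpace ℝ (Fin N) → ℝ := fun y => u true y - u false y
    - (u true (σ y) - u false (σ y)) + (sphereOsc u ‖y‖ + sphereOsc u ‖σ y‖ - 2 * sphereOsc u r)
    with hΞ
  have hPc : Continuous P := by rw [hP]; fun_prop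
  have hPlow : ∀ y ∈ S, κ * ‖y - r • e‖ ^ 2 ≤ P y := by
    intro y hy
    have h1 : ⟪y, e⟫ - r ≤ ρ := by
      have h2 := real_inner_le_norm (y - r • e) e
      rw [inner_sub_left, inner_smul_left, real_inner_self_eq_norm_sq, he] at h2
      simp at h2
      linarith [hy.1]
    have h2 : 0 ≤ κ * ((N + 2) * ((⟪y, e⟫ - r) * (ρ - (⟪y, e⟫ - r)))) := by
      have := mul_nonneg (sub_nonneg.2 hy.2) (sub_nonneg.2 h1)
      positivity
    simp only [hP]
    rw [← hκρ]
    linarith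
  have hΞc : ContinuousOn Ξ S := by
    intro y hy
    obtain ⟨h1, h2, -⟩ := hball y hy.1
    obtain ⟨h3, h4, -⟩ := hball (σ y) (by rw [hσnorm]; exact hy.1)
    have hv : ∀ i, ContinuousAt (u i) y := fun i => ((hu i).contDiffAt y h2).continuousAt
    have hw : ∀ i, ContinuousAt (fun y => u i (σ y)) y := fun i =>
      ContinuousAt.comp (f := σ) ((hu i).contDiffAt (σ y) h4).continuousAt hσc.continuousAt
    have hg : ∀ s, (1 + r₀) / 2 ≤ s → s < 1 → ContinuousAt (sphereOsc u) s := fun s hs hs1 =>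
      (continuousOn_sphereOsc hu).continuousAt (Ico_mem_nhds (by linarith) hs1)
    have hg₁ : ContinuousAt (fun y => sphereOsc u ‖y‖) y :=
      ContinuousAt.comp (f := fun y => ‖y‖) (hg _ h1 h2) continuous_norm.continuousAt
    have hg₂ : ContinuousAt (fun y => sphereOsc u ‖σ y‖) y :=
      ContinuousAt.comp (f := fun y => ‖σ y‖) (hg _ h3 h4) hσc.norm.continuousAt
    exact ((((hv true).sub (hv false)).sub ((hw true).sub (hw false))).add
      ((hg₁.add hg₂).sub continuousAt_const)).continuousWithinAt
  obtain ⟨z, hz, hmax⟩ := hScpt.exists_isMaxOn ⟨y, hy, hye⟩ (hΞc.sub hPc.continuousOn)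
  suffices hle : Ξ z ≤ P z by
    have h1 : Ξ y - P y ≤ Ξ z - P z := hmax (a := y) ⟨hy, hye⟩
    change Ξ y ≤ P y
    linarith
  obtain ⟨hz1, hz2, hz3⟩ := hball z hz.1
  obtain ⟨hσz1, hσz2, hσz3⟩ := hball (σ z) (by rw [hσnorm]; exact hz.1)
  have hz0 : 0 < ‖z‖ := by linarith
  have hσz0 : 0 < ‖σ z‖ := by linarith
  have hGz := hG z hz.1
  have hGσz := hG (σ z) (by rw [hσnorm]; exact hz.1)
  rcases hz.2.eq_or_lt with hflat | hz4
  · have h1 : σ z = z := by rw [hσeq, ← hflat]; simp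
    have h2 : ‖z‖ ^ 2 = r ^ 2 + ‖z - r • e‖ ^ 2 := by
      rw [norm_sub_sq_real, inner_smul_right, ← hflat, hre]
      ring
    have h3 : r ≤ ‖z‖ := by nlinarith [sq_nonneg ‖z - r • e‖]
    have h4 := (neg_le_abs _).trans (hL r ‖z‖ (by linarith) h3 hz2)
    have h5 : ‖z‖ - r ≤ ‖z - r • e‖ ^ 2 := by nlinarith
    have h6 := mul_le_mul_of_nonneg_left h5 hL0
    have h7 : 2 * L * ‖z - r • e‖ ^ 2 ≤ κ * ‖z - r • e‖ ^ 2 :=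
      mul_le_mul_of_nonneg_right (by linarith) (sq_nonneg _)
    have h8 := hPlow z hz
    have h9 : Ξ z = 2 * (sphereOsc u ‖z‖ - sphereOsc u r) := by
      simp only [hΞ, h1]; ring
    linarith
  rcases hz.1.eq_or_lt with hround | hz5
  · have h1 := sub_le_sphereOsc hu hz0 hz2 true false (x := z) (y := z) rfl rfl
    have h2 := sub_le_sphereOsc hu hσz0 hσz2 false true (x := σ z) (y := σ z) rfl rfl
    have h3 := sphereOsc_nonneg h.one_le hu hr0.le hr1
    have h4 := hPlow z hz
    have h5 : κ * ‖z - r • e‖ ^ 2 = A * ρ := by rw [hround, ← hκρ]; ring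
    have h6 : 24 * C * ρ ≤ A * ρ := mul_le_mul_of_nonneg_right (by linarith) hρ0.le
    simp only [hΞ]
    linarith
  exfalso
  have hnhds : S ∈ 𝓝 z := by
    have hd : Continuous fun y : EuclideanSpace ℝ (Fin N) => ‖y - r • e‖ := by fun_prop
    filter_upwards [hd.continuousAt.eventually_lt_const hz5,
      hin.continuousAt.eventually_const_lt hz4] with y h1 h2 using ⟨h1.le, h2.le⟩
  obtain ⟨i, j, R₁, R₂, heq, hpair⟩ := exists_sphereOsc_eq_isometry h hu hz0 hz2
  obtain ⟨k, l, R₃, R₄, heq', hpair'⟩ := exists_sphereOsc_eq_isometry h hu hσz0 hσz2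
  have hloc : IsLocalMax (fun y => u true y - u false y - (u true (σ y) - u false (σ y))
      + (u i (R₁ y) - u j (R₂ y)) + (u k (R₃ (σ y)) - u l (R₄ (σ y))) - P y) z := by
    filter_upwards [hnhds] with y hy
    obtain ⟨h1, h2, -⟩ := hball y hy.1
    obtain ⟨h3, h4, -⟩ := hball (σ y) (by rw [hσnorm]; exact hy.1)
    have h5 := sub_le_sphereOsc hu (by linarith) h2 i j (R₁.norm_map y) (R₂.norm_map y)
    have h6 := sub_le_sphereOsc hu (by linarith) h4 k l (R₃.norm_map (σ y)) (R₄.norm_map (σ y))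
    have h7 : Ξ y - P y ≤ Ξ z - P z := hmax hy
    simp only [hΞ] at h7
    linarith
  have hid : ∀ i, HasLaplAt (u i) (f (u i z)) z := fun i => by
    have := hasLaplAt_comp (T := id) (x := z) (R := LinearIsometryEquiv.refl ℝ _) (by simp)
      ((hu i).contDiffAt z hz2)
    rwa [id, (hu i).lapl_eq z hz2] at this
  have hlin : ∀ i (Q : EuclideanSpace ℝ (Fin N) ≃ₗᵢ[ℝ] EuclideanSpace ℝ (Fin N)),
      HasLaplAt (fun y => u i (Q y)) (f (u i (Q z))) z := fun i Q => by
    have hQ : ‖Q z‖ < 1 := by rwa [Q.norm_map]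
    have := hasLaplAt_comp (T := Q) (x := z) (R := Q) (by simp) ((hu i).contDiffAt _ hQ)
    rwa [(hu i).lapl_eq _ hQ] at this
  have haff : ∀ i (Q : EuclideanSpace ℝ (Fin N) ≃ₗᵢ[ℝ] EuclideanSpace ℝ (Fin N)),
      HasLaplAt (fun y => u i (Q (σ y))) (f (u i (Q (σ z)))) z := fun i Q => by
    have hQ : ‖Q (σ z)‖ < 1 := by rwa [Q.norm_map]
    have := hasLaplAt_comp (T := fun y => Q (σ y)) (x := z) (R := R.trans Q)
      (fun v => by simp [hσadd]) ((hu i).contDiffAt _ hQ)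
    rwa [(hu i).lapl_eq _ hQ] at this
  have hσid : ∀ i, HasLaplAt (fun y => u i (σ y)) (f (u i (σ z))) z := fun i =>
    haff i (LinearIsometryEquiv.refl ℝ _)
  have hlapl := (((((hid true).sub (hid false)).sub ((hσid true).sub (hσid false))).add
    ((hlin i R₁).sub (hlin j R₂))).add ((haff k R₃).sub (haff l R₄))).sub
    (hasLaplAt_saddle κ (A * (N + 2)) r he z) |>.nonpos_of_isLocalMax hloc
  have h1 := hpair true false
  have h2 := hpair' false true
  have h3 := mul_le_mul_of_nonneg_left hGz hK
  have h4 := mul_le_mul_of_nonneg_left hGσz hK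
  have h5 : K * C * ρ ≤ K * C := mul_le_of_le_one_right hKC hρ1
  linarith

theorem exists_fderiv_radial_le (h : ThinAnnulus N f a K r₀)
    (hu : ∀ i, BlowsUpAbove f a r₀ (u i)) :
    ∃ A, 0 ≤ A ∧ ∀ r e, ‖e‖ = 1 → 1 - r ≤ (1 - r₀) / 3 → r < 1 →
      fderiv ℝ (u true) (r • e) e - fderiv ℝ (u false) (r • e) e ≤ A := by
  obtain ⟨C, hC0, hC⟩ := exists_sphereOsc_le h hu
  obtain ⟨L, hL0, hL⟩ := exists_sphereOsc_lipschitz h hu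
  have hr₀ := h.le_radius
  have hr₀1 := h.lt_one
  have hKC : 0 ≤ K * C := mul_nonneg h.K_nonneg hC0
  set A := 2 * L + 24 * C + 6 * (K * C) + 1 with hA
  have hA0 : 0 < A := by positivity
  refine ⟨A * (N + 2) + 2 * L, by positivity, fun r e he hr hr1 => ?_⟩
  have hr0 : 0 < r := by linarith
  have hre : ‖r • e‖ < 1 := by rwa [norm_smul_unit hr0.le he]
  have hline : ∀ i (w : EuclideanSpace ℝ (Fin N)),
      HasDerivAt (fun t : ℝ => u i (r • e + t • w)) (fderiv ℝ (u i) (r • e) w) 0 := fun i w =>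
    (((hu i).contDiffAt _ hre).differentiableAt (by norm_num)).hasFDerivAt.hasLineDerivAt w
  have hder := ((hline true e).sub (hline false e)).sub
    ((hline true (-e)).sub (hline false (-e)))
  have hev : ∀ᶠ t : ℝ in 𝓝[>] 0, t < (1 - r) / 2 :=
    eventually_nhdsWithin_of_eventually_nhds (eventually_lt_nhds (by linarith))
  have := HasDerivAt.le_of_eventually_le (C := A * (N + 2) + 2 * L) hder (by simp) (by
    filter_upwards [hev, self_mem_nhdsWithin] with t ht (ht0 : 0 < t)
    have hee : ⟪e, e⟫ = 1 := by rw [real_inner_self_eq_norm_sq, he]; norm_num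
    have hin : ⟪r • e + t • e, e⟫ = r + t := by
      rw [← add_smul, inner_smul_left, hee]
      simp
    have hnorm : ‖r • e + t • e - r • e‖ = t := by
      rw [add_sub_cancel_left, norm_smul_unit ht0.le he]
    have h1 := sub_tangentReflection_le h hu hC0 hC hL0 hL le_rfl hr hr1 he (r • e + t • e)
      (by rw [hnorm]; exact ht.le) (by rw [hin]; linarith)
    rw [reflection_orthogonal_singleton he, hnorm, hin] at h1
    have h2 : r • e + t • e - (2 * (r + t)) • e + (2 * r) • e = r • e + t • -e := by module
    have h3 : ‖r • e + t • e‖ = r + t := by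
      rw [← add_smul, norm_smul_unit (by linarith) he]
    have h4 : ‖r • e + t • -e‖ = r - t := by
      rw [smul_neg, ← sub_eq_add_neg, ← sub_smul, norm_smul_unit (by linarith) he]
    rw [h2, h3, h4] at h1
    have h5 := (le_abs_self _).trans (hL r (r + t) (by linarith) (by linarith) (by linarith))
    have h6 := (neg_le_abs _).trans (hL (r - t) r (by linarith) (by linarith) hr1)
    have h7 : 0 ≤ A / ((1 - r) / 2) * ((N + 1) * t ^ 2) := by
      have : 0 ≤ A / ((1 - r) / 2) := div_nonneg hA0.le (by linarith)
      positivity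
    simp only [Pi.sub_apply]
    linarith)
  simp only [map_neg] at this
  have h8 : 0 ≤ A * (N + 2) + 2 * L := by positivity
  linarith

end RadialDerivative

section GradientBound

open scoped RealInnerProductSpace

variable {N : ℕ} {f : ℝ → ℝ} {a K r₀ : ℝ} {u : Bool → EuclideanSpace ℝ (Fin N) → ℝ}

theorem norm_le_of_radial_tangential {D : EuclideanSpace ℝ (Fin N) →L[ℝ] ℝ}
    {e : EuclideanSpace ℝ (Fin N)} {A₁ A₂ : ℝ} (he : ‖e‖ = 1) (hA₁ : 0 ≤ A₁) (hA₂ : 0 ≤ A₂)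
    (hrad : |D e| ≤ A₁) (htan : ∀ ν, ‖ν‖ = 1 → ⟪e, ν⟫ = 0 → |D ν| ≤ A₂) : ‖D‖ ≤ A₁ + A₂ := by
  refine D.opNorm_le_bound (by positivity) fun w => ?_
  have hee : ⟪e, e⟫ = 1 := by rw [real_inner_self_eq_norm_sq, he]; norm_num
  set τ := w - ⟪w, e⟫ • e with hτ
  have hort : ⟪e, τ⟫ = 0 := by
    rw [hτ, inner_sub_right, inner_smul_right, hee, real_inner_comm]
    ring
  have hw : w = ⟪w, e⟫ • e + τ := by rw [hτ]; abel
  have hα : |⟪w, e⟫| ≤ ‖w‖ := by simpa [he] using abs_real_inner_le_norm w e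
  have hτw : ‖τ‖ ≤ ‖w‖ := by
    have h1 : ‖w‖ ^ 2 = ⟪w, e⟫ ^ 2 + ‖τ‖ ^ 2 := by
      conv_lhs => rw [hw]
      rw [norm_add_sq_real, inner_smul_left, hort, norm_smul, he]
      simp
    nlinarith [norm_nonneg w, norm_nonneg τ, sq_nonneg ⟪w, e⟫]
  have hDτ : |D τ| ≤ A₂ * ‖τ‖ := by
    rcases (norm_nonneg τ).eq_or_lt with h0 | h0
    · rw [norm_eq_zero.1 h0.symm]; simp
    · obtain ⟨ν, hν, hτν⟩ := eq_smul_unit h0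
      rw [hτν, inner_smul_right, mul_eq_zero] at hort
      have h1 := htan ν hν (hort.resolve_left h0.ne')
      have h2 : D τ = ‖τ‖ * D ν := by conv_lhs => rw [hτν, map_smul, smul_eq_mul]
      rw [h2, abs_mul, abs_norm, mul_comm]
      exact mul_le_mul_of_nonneg_right h1 h0.le
  have hDw : D w = ⟪w, e⟫ * D e + D τ := by
    conv_lhs => rw [hw, map_add, map_smul, smul_eq_mul]
  rw [hDw, Real.norm_eq_abs]
  refine (abs_add_le _ _).trans ?_
  rw [abs_mul]
  have h1 := mul_le_mul hα hrad (abs_nonneg _) (norm_nonneg w)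
  have h2 := mul_le_mul_of_nonneg_left hτw hA₂
  linarith

theorem exists_norm_fderiv_sub_le (h : ThinAnnulus N f a K r₀)
    (hu : ∀ i, BlowsUpAbove f a r₀ (u i)) :
    ∃ A, 0 ≤ A ∧ ∀ x, ‖x‖ < 1 → ‖fderiv ℝ (u true) x - fderiv ℝ (u false) x‖ ≤ A := by
  obtain ⟨A₁, hA₁0, hA₁⟩ := exists_fderiv_radial_le h hu
  obtain ⟨A₂, hA₂0, hA₂⟩ := exists_fderiv_radial_le h (u := fun i => u !i) fun i => hu !i
  choose B hB0 hB using fun i => exists_fderiv_tangential_le h (hu i)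
  have hr₀ := h.le_radius
  have hr₀1 := h.lt_one
  have hr1 : 1 - (1 - r₀) / 3 < 1 := by linarith
  choose M hM0 hM using fun i => (hu i).exists_norm_fderiv_le hr1
  have hB0t := hB0 true
  have hB0f := hB0 false
  have hM0t := hM0 true
  have hM0f := hM0 false
  refine ⟨(A₁ + A₂ + (B true + B false)) + (M true + M false), by positivity, fun x hx => ?_⟩
  rcases le_total ‖x‖ (1 - (1 - r₀) / 3) with hxr | hxr
  · have h1 := norm_sub_le (fderiv ℝ (u true) x) (fderiv ℝ (u false) x)
    linarith [hM true x hxr, hM false x hxr]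
  · obtain ⟨e, he, hxe⟩ := eq_smul_unit (x := x) (by linarith)
    have h1 := hA₁ ‖x‖ e he (by linarith) hx
    have h2 := hA₂ ‖x‖ e he (by linarith) hx
    rw [← hxe] at h1 h2
    simp only [Bool.not_true, Bool.not_false] at h2
    refine (norm_le_of_radial_tangential (A₁ := A₁ + A₂) (A₂ := B true + B false) he
      (by positivity) (by positivity) ?_ fun ν hν hort => ?_).trans (by linarith)
    · rw [sub_apply, abs_le]
      constructor <;> linarith
    · have hxν : ⟪x, ν⟫ = 0 := by rw [hxe, inner_smul_left, hort, mul_zero]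
      have hle : ∀ i, |fderiv ℝ (u i) x ν| ≤ B i := fun i => by
        have h3 := hB i ν x hν (by linarith) hx hxν
        have h4 := hB i (-ν) x (by rwa [norm_neg]) (by linarith) hx
          (by rw [inner_neg_right, hxν, neg_zero])
        rw [map_neg] at h4
        exact abs_le.2 ⟨by linarith, h3⟩
      rw [sub_apply]
      exact (abs_sub _ _).trans (add_le_add (hle true) (hle false))

end GradientBound

theorem stmt2 {N : ℕ} (hN : 1 ≤ N)
    (f : ℝ → ℝ) (hf : Continuous f)
    (a : ℝ) (ha : 0 < f a) (hfpos : ∀ t, a < t → 0 ≤ f t)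
    (F : ℝ → ℝ) (hF : ∀ t, F t = ∫ s in a..t, f s)
    (hKO : ∃ M, a < M ∧ IntegrableOn (fun t => 1 / Real.sqrt (F t)) (Ici M))
    (f' : ℝ → ℝ) (K : ℝ) (hf'mono : Monotone f') (hpert : ∀ t, f t = f' t - K * t)
    (u₁ u₂ : EuclideanSpace ℝ (Fin N) → ℝ)
    (h₁ : IsLargeSolution f u₁) (h₂ : IsLargeSolution f u₂) :
    ∃ C > 0, ∀ x ∈ ball (0 : EuclideanSpace ℝ (Fin N)) 1,
      ‖gradient u₁ x - gradient u₂ x‖ ≤ C := by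
  obtain ⟨ρ₁, hρ₁, hgt₁⟩ := h₁.exists_forall_lt a
  obtain ⟨ρ₂, hρ₂, hgt₂⟩ := h₂.exists_forall_lt a
  set k := max K 0 with hk
  have hk0 : 0 ≤ k := le_max_right _ _
  set δ : ℝ := 1 / (64 * (N + k + 1)) with hδ
  have hδ0 : 0 < δ := by positivity
  have hδe : δ * (64 * (N + k + 1)) = 1 := div_mul_cancel₀ _ (by positivity)
  set r₀ := max (max ρ₁ ρ₂) (1 - δ) with hr₀
  have hr₀δ : 1 - r₀ ≤ δ := by linarith [le_max_right (max ρ₁ ρ₂) (1 - δ)]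
  have hρ₁r₀ : ρ₁ ≤ r₀ := (le_max_left _ _).trans (le_max_left _ _)
  have hρ₂r₀ : ρ₂ ≤ r₀ := (le_max_right _ _).trans (le_max_left _ _)
  have hNδ : 0 ≤ (N : ℝ) * δ := by positivity
  have hkδ : 0 ≤ k * δ := by positivity
  have h : ThinAnnulus N f a k r₀ :=
    { one_le := hN
      nonneg := hfpos
      K_nonneg := hk0
      le_add := fun s t hst => by
        have h3 := hf'mono hst
        have h4 := mul_le_mul_of_nonneg_right (le_max_left K 0) (sub_nonneg.2 hst)
        rw [hpert, hpert]
        linarith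
      thin := by
        have := mul_le_mul_of_nonneg_left hr₀δ (by positivity : (0 : ℝ) ≤ 64 * N)
        linarith
      K_thin := by
        have := mul_le_mul_of_nonneg_left hr₀δ hk0
        linarith
      lt_one := max_lt (max_lt hρ₁ hρ₂) (by linarith) }
  obtain ⟨A, hA0, hA⟩ := exists_norm_fderiv_sub_le (u := fun i => bif i then u₁ else u₂) h
    fun i => by
      cases i
      · exact h₂.blowsUpAbove fun x hx hx1 => hgt₂ x (hρ₂r₀.trans hx) hx1
      · exact h₁.blowsUpAbove fun x hx hx1 => hgt₁ x (hρ₁r₀.trans hx) hx1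
  refine ⟨A + 1, by positivity, fun x hx => ?_⟩
  have h3 := hA x (mem_ball_zero_iff.1 hx)
  simp only [cond_true, cond_false] at h3
  rw [gradient, gradient, ← map_sub, LinearIsometryEquiv.norm_map]
  linarith
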